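/- arXiv:2108.00431 — 3 statements merged into one kernel-verified Lean document; each statement's English description precedes it below -/
import Mathlib

section
/- Let (a_n) be a lacunary sequence of positive real numbers (a_{n+1}/a_n ≥ c > 1 for all n). Then for almost every α ∈ ℝ and every k ≥ 2, the sequence (α a_n) mod 1 has Poissonian k-level correlation: for every compactly supported smooth f : ℝ^{k−1} → ℝ, the k-level correlation sum R_k(f,(α a_n),N) converges to ∫_{ℝ^{k−1}} f(x) dx as N → ∞. -/
open MeasureTheory Filter

/-- The `k`-level correlation sum `R_k(f, (b_n), N)`. -/
noncomputable def corrSum (k N : ℕ) (b : ℕ → ℝ) (f : (Fin (k - 1) → ℝ) → ℝ) : ℝ :=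
  (1 / (N : ℝ)) * ∑' m : Fin (k - 1) → ℤ,
    ∑ x ∈ (Fintype.piFinset fun _ : Fin k => Finset.Icc 1 N).filter
        (fun x => Function.Injective x),
      f (fun i => (N : ℝ) * ((b (x ⟨i.1, by have := i.2; omega⟩)
          - b (x ⟨i.1 + 1, by have := i.2; omega⟩)) - (m i : ℝ)))

/-- `C_k(N) = (1 - 1/N) ⋯ (1 - (k-1)/N)`. -/
noncomputable def Ck (k N : ℕ) : ℝ :=
  ∏ j ∈ Finset.Icc 1 (k - 1), (1 - (j : ℝ) / (N : ℝ))



namespace LacPC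

/-- Centered representative of a point on the circle. -/
noncomputable def rep (t : UnitAddCircle) : ℝ :=
  Function.Periodic.lift (f := fun x : ℝ => x - round x) (c := (1:ℝ))
    (by intro x; simp [round_add_one]) t

lemma rep_coe (x : ℝ) : rep (x : UnitAddCircle) = x - round x := rfl

lemma abs_rep (t : UnitAddCircle) : |rep t| = ‖t‖ := by
  induction t using QuotientAddGroup.induction_on with
  | H x => exact UnitAddCircle.norm_eq.symm

lemma abs_rep_le (t : UnitAddCircle) : |rep t| ≤ 1 / 2 := by
  rw [abs_rep]
  simpa using AddCircle.norm_le_half_period (p := (1:ℝ)) (x := t) one_ne_zero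

lemma coe_int_zero (m : ℤ) : ((m : ℝ) : UnitAddCircle) = 0 := by
  rw [AddCircle.coe_eq_zero_iff]
  exact ⟨m, by simp⟩

lemma coe_rep (t : UnitAddCircle) : ((rep t : ℝ) : UnitAddCircle) = t := by
  induction t using QuotientAddGroup.induction_on with
  | H x =>
    change (((x - round x : ℝ)) : UnitAddCircle) = (x : UnitAddCircle)
    rw [AddCircle.coe_sub, coe_int_zero, sub_zero]

/-- If `p` represents `t`, then either `p = rep t` or both are at least `1/2` off. -/
lemma rep_alt (p : ℝ) : rep (p : UnitAddCircle) = p ∨ 1 / 2 ≤ |p| := by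
  by_cases h : round p = 0
  · left; rw [rep_coe, h]; simp
  · right
    have h1 : (1:ℝ) ≤ |(round p : ℝ)| := by
      have := Int.one_le_abs h
      exact_mod_cast this
    have h2 := abs_sub_round p
    have h3 : |(round p : ℝ)| ≤ |p| + |p - round p| := by
      have := abs_sub p (p - round p)
      simpa using this
    linarith

variable {n : ℕ}

/-- Periodised test function on the torus. -/
noncomputable def HH (f : (Fin n → ℝ) → ℝ) (N : ℕ) (d : Fin n → UnitAddCircle) : ℝ :=
  f (fun i => (N : ℝ) * rep (d i))

lemma big_zero {f : (Fin n → ℝ) → ℝ} {ρ : ℕ} (hf : ∀ y, (ρ : ℝ) < ‖y‖ → f y = 0)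
    {N : ℕ} (hN : 2 * ρ < N) (p : Fin n → ℝ) (i : Fin n) (hi : 1 / 2 ≤ |p i|) :
    f (fun i => (N : ℝ) * p i) = 0 := by
  apply hf
  have h1 := norm_le_pi_norm (fun i => (N : ℝ) * p i) i
  have hN' : (2 : ℝ) * ρ < N := by exact_mod_cast hN
  have h2 : (N : ℝ) * (1 / 2) ≤ ‖(N : ℝ) * p i‖ := by
    rw [norm_mul, Real.norm_eq_abs, Real.norm_eq_abs, abs_of_nonneg (Nat.cast_nonneg N)]
    gcongr
  linarith

lemma HH_coe {f : (Fin n → ℝ) → ℝ} {ρ : ℕ} (hf : ∀ y, (ρ : ℝ) < ‖y‖ → f y = 0)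
    {N : ℕ} (hN : 2 * ρ < N) (p : Fin n → ℝ) (hp : ∀ i, |p i| ≤ 1 / 2) :
    HH f N (fun i => (p i : UnitAddCircle)) = f (fun i => (N : ℝ) * p i) := by
  by_cases h : ∀ i, rep (p i : UnitAddCircle) = p i
  · simp only [HH, h]
  · push Not at h
    obtain ⟨i, hi⟩ := h
    have h1 := (rep_alt (p i)).resolve_left hi
    rw [big_zero hf hN p i h1, HH]
    apply big_zero hf hN _ i
    have h3 := abs_rep (p i : UnitAddCircle)
    have h4 := (AddCircle.norm_coe_eq_abs_iff (p := (1:ℝ)) (x := p i) one_ne_zero).2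
      (by simpa using hp i)
    rw [h3]
    exact h1.trans h4.ge

lemma lip_scaled {f : (Fin n → ℝ) → ℝ} {Λ : NNReal} (hL : LipschitzWith Λ f) (N : ℕ)
    (p q : Fin n → ℝ) (δ : ℝ) (hδ : 0 ≤ δ) (h : ∀ i, |p i - q i| ≤ δ) :
    |f (fun i => (N : ℝ) * p i) - f (fun i => (N : ℝ) * q i)| ≤ Λ * (N * δ) := by
  have := hL.dist_le_mul (fun i => (N : ℝ) * p i) (fun i => (N : ℝ) * q i)
  rw [Real.dist_eq] at this
  refine this.trans ?_
  gcongr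
  rw [dist_pi_le_iff (by positivity)]
  intro i
  rw [Real.dist_eq, ← mul_sub, abs_mul, abs_of_nonneg (Nat.cast_nonneg N)]
  gcongr
  exact h i

lemma HH_lip {f : (Fin n → ℝ) → ℝ} {ρ : ℕ} (hf : ∀ y, (ρ : ℝ) < ‖y‖ → f y = 0)
    {Λ : NNReal} (hL : LipschitzWith Λ f) {N : ℕ} (hN : 2 * ρ < N) :
    LipschitzWith (2 * Λ * N) (HH f N) := by
  apply LipschitzWith.of_dist_le_mul
  intro d' d
  have key : ∀ i, ∃ q : ℝ, ((q : ℝ) : UnitAddCircle) = d' i ∧ |rep (d i) - q| ≤ dist d' d := by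
    intro i
    refine ⟨rep (d i) + rep (d' i - d i), ?_, ?_⟩
    · rw [AddCircle.coe_add, coe_rep, coe_rep]; abel
    · have : rep (d i) - (rep (d i) + rep (d' i - d i)) = - rep (d' i - d i) := by ring
      rw [this, abs_neg, abs_rep, ← dist_eq_norm]
      exact dist_le_pi_dist d' d i
  choose q hq hqd using key
  have hd0 : 0 ≤ dist d' d := dist_nonneg
  have hm : ∀ i, rep (d' i) = q i - round (q i) := fun i => by rw [← hq i, rep_coe]
  have A : |f (fun i => (N : ℝ) * rep (d i)) - f (fun i => (N : ℝ) * q i)| ≤ Λ * (N * dist d' d) :=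
    lip_scaled hL N _ _ _ hd0 hqd
  rw [Real.dist_eq]
  have hcast : (((2 * Λ * N : NNReal)) : ℝ) * dist d' d = 2 * (Λ * (N * dist d' d)) := by
    push_cast; ring
  rw [hcast]
  have hnn : 0 ≤ Λ * (N * dist d' d) := by positivity
  by_cases h : ∀ i, round (q i) = 0
  · have : HH f N d' = f (fun i => (N : ℝ) * q i) := by
      simp [HH, hm, h]
    rw [this, HH, abs_sub_comm]
    linarith
  · push Not at h
    obtain ⟨i, hi⟩ := h
    have h1 : (1:ℝ) ≤ |(round (q i) : ℝ)| := by
      have := Int.one_le_abs hi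
      exact_mod_cast this
    have z1 : f (fun i => (N : ℝ) * q i) = 0 := by
      apply big_zero hf hN q i
      have h2 := abs_sub_round (q i)
      have h3 : |(round (q i) : ℝ)| ≤ |q i| + |q i - round (q i)| := by
        have := abs_sub (q i) (q i - round (q i))
        simpa using this
      linarith
    have z2 : f (fun i => (N : ℝ) * (rep (d i) - round (q i))) = 0 := by
      apply big_zero hf hN (fun i => rep (d i) - round (q i)) i
      have h2 := abs_rep_le (d i)
      have h3 : |(round (q i) : ℝ)| ≤ |rep (d i)| + |rep (d i) - round (q i)| := by
        have := abs_sub (rep (d i)) (rep (d i) - round (q i))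
        simpa using this
      change 1 / 2 ≤ |rep (d i) - round (q i)|
      linarith
    have B : |f (fun i => (N : ℝ) * (rep (d i) - round (q i)))
        - f (fun i => (N : ℝ) * (q i - round (q i)))| ≤ Λ * (N * dist d' d) :=
      lip_scaled hL N _ _ _ hd0 (fun i => by
        have : rep (d i) - (round (q i)) - (q i - round (q i)) = rep (d i) - q i := by ring
        rw [this]; exact hqd i)
    rw [z1, sub_zero] at A
    rw [z2, zero_sub, abs_neg] at B
    have e1 : HH f N d' = f (fun i => (N : ℝ) * (q i - round (q i))) := by
      simp only [HH, hm]
    rw [e1, HH]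
    have := abs_sub (f (fun i => (N : ℝ) * (q i - round (q i)))) (f (fun i => (N : ℝ) * rep (d i)))
    linarith

lemma HH_int {f : (Fin n → ℝ) → ℝ} {ρ : ℕ} (hf : ∀ y, (ρ : ℝ) < ‖y‖ → f y = 0)
    (hc : Continuous (HH f N)) (hN : 2 * ρ < N) :
    ∫ d, HH f N d = ((N : ℝ) ^ n)⁻¹ * ∫ y, f y := by
  have mp := measurePreserving_pi (fun _ : Fin n => (volume : Measure ℝ).restrict (Set.Ioc (-1/2) (-1/2 + 1)))
    (fun _ => (volume : Measure UnitAddCircle)) (fun i => UnitAddCircle.measurePreserving_mk (-1/2))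
  have e0 : ∫ d, HH f N d = ∫ d, HH f N d ∂(Measure.pi fun _ : Fin n => (volume : Measure UnitAddCircle)) := rfl
  rw [e0, ← mp.map_eq, integral_map mp.measurable.aemeasurable hc.aestronglyMeasurable,
    ← Measure.restrict_pi_pi, ← volume_pi]
  have e1 : ∫ p in Set.univ.pi fun _ : Fin n => Set.Ioc (-1/2:ℝ) (-1/2+1),
      HH f N (fun i => ((p i : ℝ) : UnitAddCircle))
      = ∫ p in Set.univ.pi fun _ : Fin n => Set.Ioc (-1/2:ℝ) (-1/2+1), f ((N : ℝ) • p) := by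
    apply setIntegral_congr_fun (MeasurableSet.univ_pi fun _ => measurableSet_Ioc)
    intro p hp
    rw [Set.mem_univ_pi] at hp
    refine (HH_coe hf hN p fun i => ?_).trans rfl
    have := hp i
    rw [Set.mem_Ioc] at this
    rw [abs_le]; constructor <;> linarith [this.1, this.2]
  refine e1.trans ?_
  rw [setIntegral_eq_integral_of_forall_compl_eq_zero, Measure.integral_comp_smul]
  · simp
  · intro p hp
    rw [Set.mem_univ_pi] at hp
    push Not at hp
    obtain ⟨i, hi⟩ := hp
    refine big_zero hf hN p i ?_
    rw [Set.mem_Ioc] at hi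
    by_contra hcon
    push Not at hcon
    rw [abs_lt] at hcon
    exact hi ⟨by linarith [hcon.1], by linarith [hcon.2]⟩

/-- consecutive differences -/
def dif (t : Fin (n+1) → UnitAddCircle) : Fin n → UnitAddCircle :=
  fun i => t i.castSucc - t i.succ

lemma dif_mp : MeasurePreserving (dif (n := n)) volume volume := by
  let φ : (Fin (n+1) → UnitAddCircle) →+ (Fin n → UnitAddCircle) :=
    { toFun := dif
      map_zero' := by ext i; simp [dif]
      map_add' := by intro x y; ext i; simp only [dif, Pi.add_apply]; abel }
  have hcont : Continuous φ := by
    change Continuous dif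
    unfold dif
    fun_prop
  have hsurj : Function.Surjective φ := by
    intro d
    refine ⟨fun i => Fin.induction (motive := fun _ => UnitAddCircle) 0 (fun i acc => acc - d i) i, ?_⟩
    funext i
    change Fin.induction (motive := fun _ => UnitAddCircle) 0 (fun i acc => acc - d i) i.castSucc
      - Fin.induction (motive := fun _ => UnitAddCircle) 0 (fun i acc => acc - d i) i.succ = d i
    rw [Fin.induction_succ]
    abel
  refine φ.measurePreserving hcont hsurj ?_
  rw [volume_pi, volume_pi, Measure.pi_univ, Measure.pi_univ]
  simp

lemma dif_lip : LipschitzWith 2 (dif (n := n)) := by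
  apply LipschitzWith.of_dist_le_mul
  intro x y
  rw [dist_pi_le_iff (by positivity)]
  intro i
  have h1 := dist_le_pi_dist x y i.castSucc
  have h2 := dist_le_pi_dist x y i.succ
  have := dist_sub_sub_le (x i.castSucc) (x i.succ) (y i.castSucc) (y i.succ)
  simp only [dif]
  push_cast
  linarith

noncomputable def FF (f : (Fin n → ℝ) → ℝ) (N : ℕ) (t : Fin (n+1) → UnitAddCircle) : ℝ :=
  HH f N (dif t)

lemma FF_lip {f : (Fin n → ℝ) → ℝ} {ρ : ℕ} (hf : ∀ y, (ρ : ℝ) < ‖y‖ → f y = 0)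
    {Λ : NNReal} (hL : LipschitzWith Λ f) {N : ℕ} (hN : 2 * ρ < N) :
    LipschitzWith (2 * Λ * N * 2) (FF f N) :=
  (HH_lip hf hL hN).comp dif_lip

lemma FF_int {f : (Fin n → ℝ) → ℝ} {ρ : ℕ} (hf : ∀ y, (ρ : ℝ) < ‖y‖ → f y = 0)
    {Λ : NNReal} (hL : LipschitzWith Λ f) {N : ℕ} (hN : 2 * ρ < N) :
    ∫ t, FF f N t = ((N : ℝ) ^ n)⁻¹ * ∫ y, f y := by
  have hc := (HH_lip hf hL hN).continuous
  rw [← HH_int hf hc hN]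
  have e : ∫ d, HH f N d = ∫ d, HH f N d ∂(Measure.map (dif (n := n)) volume) := by
    rw [dif_mp.map_eq]
  rw [e, integral_map dif_mp.measurable.aemeasurable hc.aestronglyMeasurable]
  rfl

end LacPC


namespace LacPC

set_option linter.unusedSectionVars false

variable {ι : Type*} [Fintype ι] [DecidableEq ι]

/-- Coordinates in `s` are driven by `α`, the others by `U`. -/
def mix (b : ι → ℝ) (s : Finset ι) (U : ι → UnitAddCircle) (α : ℝ) : ι → UnitAddCircle :=
  fun j => if j ∈ s then ((α * b j : ℝ) : UnitAddCircle) else U j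

lemma mix_cont (b : ι → ℝ) (s : Finset ι) :
    Continuous (fun p : (ι → UnitAddCircle) × ℝ => mix b s p.1 p.2) := by
  apply continuous_pi
  intro j
  unfold mix
  by_cases h : j ∈ s
  · simp only [h, if_true]
    exact (AddCircle.continuous_mk' 1).comp (by fun_prop)
  · simp only [h, if_false]
    fun_prop

lemma norm_coe_le (x : ℝ) : ‖(x : UnitAddCircle)‖ ≤ |x| := by
  rw [UnitAddCircle.norm_eq]
  simpa using round_le x 0

lemma step_pt {F : (ι → UnitAddCircle) → ℝ} {K : NNReal} (hF : LipschitzWith K F) {B : ℝ}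
    (hB : ∀ t, |F t| ≤ B) {T : ℝ} (hT : 0 < T) (b : ι → ℝ) (s : Finset ι) (i : ι) (hi : i ∉ s)
    (hbi : T ≤ b i) (hb0 : ∀ j ∈ s, 0 ≤ b j) (hb : ∀ j ∈ s, T * b j ≤ b i)
    (U : ι → UnitAddCircle) (A σ : ℝ) (h0 : 0 ≤ σ) (h1 : σ ≤ 1) :
    |(∫ α in A..(A+1), F (mix b (insert i s) U α)) -
      ∫ α in A..(A+1), F (mix b (insert i s) U α + Pi.single i (σ : UnitAddCircle))|
      ≤ (K + 2 * B) / T := by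
  have hbpos : 0 < b i := hT.trans_le hbi
  have hB0 : 0 ≤ B := (abs_nonneg _).trans (hB 0)
  set h := σ / b i with hh
  have hh0 : 0 ≤ h := by positivity
  have hhT : h ≤ 1 / T := by
    rw [hh]; gcongr
  set p : ℝ → ℝ := fun α => F (mix b (insert i s) U α) with hp
  have hpc : Continuous p := hF.continuous.comp
    ((mix_cont b (insert i s)).comp (by fun_prop : Continuous fun α : ℝ => (U, α)))
  have hpi : ∀ x y, IntervalIntegrable p volume x y := fun x y => hpc.intervalIntegrable x y
  set r : ℝ → ℝ := fun α => F (mix b (insert i s) U α + Pi.single i (σ : UnitAddCircle)) with hr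
  have hrc : Continuous r := hF.continuous.comp
    (((mix_cont b (insert i s)).comp (by fun_prop : Continuous fun α : ℝ => (U, α))).add
      continuous_const)
  have hri : ∀ x y, IntervalIntegrable r volume x y := fun x y => hrc.intervalIntegrable x y
  have S1 : (∫ α in A..(A+1), p α) - ∫ α in A..(A+1), p (α + h)
      = (∫ α in A..(A+h), p α) - ∫ α in (A+1)..(A+1+h), p α := by
    rw [intervalIntegral.integral_comp_add_right]
    have e1 := intervalIntegral.integral_add_adjacent_intervals (hpi A (A+h)) (hpi (A+h) (A+1))
    have e2 := intervalIntegral.integral_add_adjacent_intervals (hpi (A+h) (A+1)) (hpi (A+1) (A+1+h))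
    linarith
  have bd : ∀ x, |∫ α in x..(x+h), p α| ≤ B * (1 / T) := by
    intro x
    have := intervalIntegral.norm_integral_le_of_norm_le_const (a := x) (b := x + h) (C := B)
      (f := p) (fun y _ => hB _)
    rw [add_sub_cancel_left, abs_of_nonneg hh0] at this
    exact this.trans (by gcongr)
  have S2 : |(∫ α in A..(A+1), p (α + h)) - ∫ α in A..(A+1), r α| ≤ K / T := by
    have hpc' : Continuous fun α => p (α + h) := hpc.comp (continuous_id.add continuous_const)
    rw [← intervalIntegral.integral_sub (hpc'.intervalIntegrable _ _) (hri _ _)]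
    have := intervalIntegral.norm_integral_le_of_norm_le_const (a := A) (b := A+1) (C := K / T)
      (f := fun α => p (α + h) - r α) (fun α _ => ?_)
    · simpa using this
    · have e := hF.dist_le_mul (mix b (insert i s) U (α + h))
        (mix b (insert i s) U α + Pi.single i (σ : UnitAddCircle))
      rw [← dist_eq_norm]
      refine e.trans ?_
      rw [div_eq_mul_one_div]
      gcongr
      rw [dist_pi_le_iff (by positivity)]
      intro j
      by_cases hj : j = i
      · subst hj
        have : mix b (insert j s) U (α + h) j
            = (mix b (insert j s) U α + Pi.single j (σ : UnitAddCircle) : ι → UnitAddCircle) j := by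
          simp only [mix, Finset.mem_insert_self, if_true, Pi.add_apply, Pi.single_eq_same,
            ← AddCircle.coe_add]
          congr 1
          rw [hh]; field_simp
        rw [this, dist_self]; positivity
      · simp only [mix, Finset.mem_insert, hj, false_or, Pi.add_apply, Pi.single_eq_of_ne hj, add_zero]
        by_cases hjs : j ∈ s
        · simp only [hjs, if_true]
          rw [dist_eq_norm, ← AddCircle.coe_sub]
          refine (norm_coe_le _).trans ?_
          have : (α + h) * b j - α * b j = h * b j := by ring
          rw [this, abs_of_nonneg (mul_nonneg hh0 (hb0 j hjs)), hh, le_div_iff₀ hT,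
            div_mul_eq_mul_div, div_mul_eq_mul_div, div_le_one hbpos]
          have := hb j hjs
          have h3 : 0 ≤ T * b j := mul_nonneg hT.le (hb0 j hjs)
          nlinarith
        · simp only [hjs, if_false, dist_self]; positivity
  have e := abs_add_le ((∫ α in A..(A+1), p α) - ∫ α in A..(A+1), p (α + h))
    ((∫ α in A..(A+1), p (α + h)) - ∫ α in A..(A+1), r α)
  rw [sub_add_sub_cancel] at e
  have e2 : |(∫ α in A..(A+1), p α) - ∫ α in A..(A+1), p (α + h)| ≤ 2 * B * (1 / T) := by
    rw [S1]
    have := abs_sub (∫ α in A..(A+h), p α) (∫ α in (A+1)..(A+1+h), p α)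
    linarith [bd A, bd (A+1)]
  calc _ ≤ _ := e
    _ ≤ 2 * B * (1/T) + K / T := by linarith
    _ = _ := by ring

lemma eq_ind {F : (ι → UnitAddCircle) → ℝ} {K : NNReal} (hF : LipschitzWith K F) {B : ℝ}
    (hB : ∀ t, |F t| ≤ B) {T : ℝ} (hT : 1 ≤ T) (b : ι → ℝ) (hb : ∀ i, T ≤ b i)
    (hsep : ∀ i j, i ≠ j → T * b i ≤ b j ∨ T * b j ≤ b i) (A : ℝ) (s : Finset ι) :
    |(∫ U, ∫ α in A..(A+1), F (mix b s U α)) - ∫ U, F U| ≤ s.card * ((K + 2 * B) / T) := by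
  have hT0 : 0 < T := by linarith
  have hb0 : ∀ i, 0 < b i := fun i => hT0.trans_le (hb i)
  have hB0 : 0 ≤ B := (abs_nonneg _).trans (hB 0)
  induction s using Finset.induction_on_max_value b with
  | empty => 
    have e : ∀ U α, mix b ∅ U α = U := by intro U α; ext j; simp [mix]
    simp [e]
  | insert i s hi hmax ih =>
    have hle : ∀ j ∈ s, T * b j ≤ b i := by
      intro j hj
      have hji : j ≠ i := fun h => hi (h ▸ hj)
      rcases hsep j i hji with h | h
      · exact h
      · have h1 := hmax j hj
        have h2 := hb0 j
        have h3 := hb0 i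
        nlinarith
    -- shifted version
    let G : (ι → UnitAddCircle) → ℝ → ℝ := fun U α =>
      F (mix b (insert i s) U α + Pi.single i (U i))
    have hGc : Continuous (Function.uncurry G) := by
      apply hF.continuous.comp
      refine (mix_cont b (insert i s)).add ?_
      apply continuous_pi
      intro j
      by_cases hj : j = i
      · subst hj; simp only [Pi.single_eq_same]; fun_prop
      · simp only [Pi.single_eq_of_ne hj]; fun_prop
    have hEc : ∀ s', Continuous (fun p : (ι → UnitAddCircle) × ℝ => F (mix b s' p.1 p.2)) :=
      fun s' => hF.continuous.comp (mix_cont b s')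
    have hinteg : ∀ g : (ι → UnitAddCircle) × ℝ → ℝ, Continuous g → (∀ p, |g p| ≤ B) →
        Integrable g (volume.prod (volume.restrict (Set.Ioc A (A+1)))) := fun g hg hgb =>
      Integrable.of_bound hg.aestronglyMeasurable B (Eventually.of_forall hgb)
    have hIoc : ∀ g : ℝ → ℝ, ∫ α in A..(A+1), g α = ∫ α in Set.Ioc A (A+1), g α := fun g =>
      intervalIntegral.integral_of_le (by linarith)
    have key : (∫ U, ∫ α in A..(A+1), F (mix b s U α)) = ∫ U, ∫ α in A..(A+1), G U α := by
      simp only [hIoc]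
      rw [integral_integral_swap (f := fun U α => F (mix b s U α)) (hinteg _ (hEc s) fun _ => hB _),
        integral_integral_swap (f := G) (hinteg _ hGc fun _ => hB _)]
      congr 1
      ext α
      rw [← integral_add_right_eq_self (fun U => F (mix b s U α))
        (Pi.single i ((α * b i : ℝ) : UnitAddCircle))]
      congr 1
      ext U
      simp only [G]
      congr 1
      ext j
      by_cases hj : j = i
      · subst hj
        simp [mix, hi, add_comm]
      · simp [mix, hj]
    have hdiff : |(∫ U, ∫ α in A..(A+1), F (mix b (insert i s) U α)) -
        ∫ U, ∫ α in A..(A+1), G U α| ≤ (K + 2 * B) / T := by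
      rw [← integral_sub]
      · have := norm_integral_le_of_norm_le_const (μ := (volume : Measure (ι → UnitAddCircle)))
          (f := fun U => (∫ α in A..(A+1), F (mix b (insert i s) U α)) - ∫ α in A..(A+1), G U α)
          (C := (K + 2 * B) / T) (Eventually.of_forall fun U => ?_)
        · simpa [Measure.real, volume_pi, Measure.pi_univ] using this
        · obtain ⟨σ, hσ, hσU⟩ : ∃ σ ∈ Set.Ico (0:ℝ) 1, ((σ : ℝ) : UnitAddCircle) = U i := by
            have := (AddCircle.coe_image_Ico_eq (1:ℝ) 0)
            have h2 : U i ∈ (QuotientAddGroup.mk : ℝ → UnitAddCircle) '' Set.Ico 0 (0+1) := by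
              rw [this]; trivial
            simpa using h2
          have := step_pt hF hB hT0 b s i hi (hb i) (fun j _ => (hb0 j).le) hle U A σ hσ.1 hσ.2.le
          rw [Real.norm_eq_abs]
          simpa only [G, ← hσU] using this
      · simp only [hIoc]
        exact (hinteg _ (hEc _) fun _ => hB _).integral_prod_left
      · simp only [hIoc]
        exact (hinteg _ hGc fun _ => hB _).integral_prod_left
    rw [← key] at hdiff
    rw [Finset.card_insert_of_notMem hi]
    push_cast
    have := abs_sub_le (∫ U, ∫ α in A..(A+1), F (mix b (insert i s) U α))
      (∫ U, ∫ α in A..(A+1), F (mix b s U α)) (∫ U, F U)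
    linarith

theorem equi {F : (ι → UnitAddCircle) → ℝ} {K : NNReal} (hF : LipschitzWith K F) {B : ℝ}
    (hB : ∀ t, |F t| ≤ B) {T : ℝ} (hT : 1 ≤ T) (b : ι → ℝ) (hb : ∀ i, T ≤ b i)
    (hsep : ∀ i j, i ≠ j → T * b i ≤ b j ∨ T * b j ≤ b i) (A : ℝ) :
    |(∫ α in Set.Ioc A (A+1), F (fun i => ((α * b i : ℝ) : UnitAddCircle))) - ∫ U, F U|
      ≤ Fintype.card ι * ((K + 2 * B) / T) := by
  have := eq_ind hF hB hT b hb hsep A Finset.univ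
  have e : ∀ U α, mix b Finset.univ U α = fun i => ((α * b i : ℝ) : UnitAddCircle) := by
    intro U α; ext i; simp [mix]
  have e2 : (volume : Measure (ι → UnitAddCircle)).real Set.univ = 1 := by
    simp [Measure.real, volume_pi, Measure.pi_univ]
  simp only [e, integral_const, e2, one_smul,
    intervalIntegral.integral_of_le (show A ≤ A + 1 by linarith), Finset.card_univ] at this
  exact this

end LacPC


namespace LacPC

/-- The point `α a_j` on the circle. -/
noncomputable def th (a : ℕ → ℝ) (α : ℝ) (j : ℕ) : UnitAddCircle := ((α * a j : ℝ) : UnitAddCircle)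

/-- injective tuples -/
def XX (k N : ℕ) : Finset (Fin k → ℕ) :=
  (Fintype.piFinset fun _ : Fin k => Finset.Icc 1 N).filter (fun x => Function.Injective x)

lemma half_le_of_round_ne {p : ℝ} (h : round p ≠ 0) : 1 / 2 ≤ |p| := by
  rcases rep_alt p with h1 | h1
  · exfalso
    rw [rep_coe] at h1
    apply h
    have : (round p : ℝ) = 0 := by linarith
    exact_mod_cast this
  · exact h1

lemma corr_eq {n : ℕ} {f : (Fin n → ℝ) → ℝ} {ρ : ℕ} (hf : ∀ y, (ρ : ℝ) < ‖y‖ → f y = 0)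
    {N : ℕ} (hN : 2 * ρ < N) (a : ℕ → ℝ) (α : ℝ) :
    corrSum (n+1) N (fun j => α * a j) f
      = (1 / (N : ℝ)) * ∑ x ∈ XX (n+1) N, FF f N (fun i => th a α (x i)) := by
  have key : HasSum (fun m : Fin n → ℤ => ∑ x ∈ XX (n+1) N,
      f (fun i => (N : ℝ) * ((α * a (x i.castSucc) - α * a (x i.succ)) - (m i : ℝ))))
      (∑ x ∈ XX (n+1) N, FF f N (fun i => th a α (x i))) := by
    apply hasSum_sum
    intro x _
    have e : FF f N (fun i => th a α (x i)) = f (fun i => (N : ℝ) *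
        ((α * a (x i.castSucc) - α * a (x i.succ)) -
          ((round (α * a (x i.castSucc) - α * a (x i.succ)) : ℤ) : ℝ))) := by
      rfl
    rw [e]
    refine hasSum_single (f := fun m : Fin n → ℤ =>
      f (fun i => (N : ℝ) * ((α * a (x i.castSucc) - α * a (x i.succ)) - (m i : ℝ))))
      (fun i => round (α * a (x i.castSucc) - α * a (x i.succ))) ?_
    intro m hm
    obtain ⟨i, hi⟩ := Function.ne_iff.1 hm
    refine big_zero hf hN (fun i => (α * a (x i.castSucc) - α * a (x i.succ)) - (m i : ℝ)) i ?_
    apply half_le_of_round_ne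
    rw [round_sub_intCast]
    intro h
    exact hi (by omega)
  rw [← key.tsum_eq]
  rfl

lemma hit_of_ne {n : ℕ} {f : (Fin n → ℝ) → ℝ} {ρ : ℝ} (hf : ∀ y, ρ < ‖y‖ → f y = 0)
    {N : ℕ} (t : Fin (n+1) → UnitAddCircle) (h : FF f N t ≠ 0) (i : Fin n) :
    (N : ℝ) * dist (t i.castSucc) (t i.succ) ≤ ρ := by
  by_contra hcon
  push Not at hcon
  apply h
  apply hf
  refine hcon.trans_le ?_
  have := norm_le_pi_norm (fun i => (N : ℝ) * rep (dif t i)) i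
  refine le_trans (le_of_eq ?_) this
  rw [norm_mul, Real.norm_eq_abs, Real.norm_eq_abs, abs_rep, abs_of_nonneg (Nat.cast_nonneg N),
    dist_eq_norm]
  rfl

lemma hit_all {n : ℕ} {ρ : ℝ} (hρ : 0 ≤ ρ) {N : ℕ} (t : Fin (n+1) → UnitAddCircle)
    (h : ∀ i : Fin n, (N : ℝ) * dist (t i.castSucc) (t i.succ) ≤ ρ) (i j : Fin (n+1)) :
    (N : ℝ) * dist (t i) (t j) ≤ 2 * n * ρ := by
  have h0 : ∀ i : Fin (n+1), (N : ℝ) * dist (t 0) (t i) ≤ i.1 * ρ := by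
    intro i
    induction i using Fin.induction with
    | zero => simp
    | succ i ih =>
      have := dist_triangle (t 0) (t i.castSucc) (t i.succ)
      have h2 := mul_le_mul_of_nonneg_left this (Nat.cast_nonneg (α := ℝ) N)
      have h3 := h i
      simp only [Fin.val_castSucc] at ih
      simp only [Fin.val_succ]
      push_cast
      linarith
  have h1 : ∀ i : Fin (n+1), (N : ℝ) * dist (t 0) (t i) ≤ n * ρ := fun i =>
    (h0 i).trans (by
      gcongr
      omega)
  have := dist_triangle_left (t i) (t j) (t 0)
  have h2 := mul_le_mul_of_nonneg_left this (Nat.cast_nonneg (α := ℝ) N)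
  linarith [h1 i, h1 j]

/-- bump function -/
noncomputable def bump (n R : ℕ) (y : Fin n → ℝ) : ℝ := max 0 ((R : ℝ) + 1 - ‖y‖)

lemma bump_nonneg (n R : ℕ) (y : Fin n → ℝ) : 0 ≤ bump n R y := le_max_left _ _

lemma bump_le (n R : ℕ) (y : Fin n → ℝ) : |bump n R y| ≤ R + 1 := by
  rw [abs_of_nonneg (bump_nonneg n R y)]
  exact max_le (by positivity) (by linarith [norm_nonneg y])

lemma bump_one (n R : ℕ) (y : Fin n → ℝ) (h : ‖y‖ ≤ R) : 1 ≤ bump n R y :=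
  le_max_of_le_right (by linarith)

lemma bump_supp (n R : ℕ) (y : Fin n → ℝ) (h : ((R + 1 : ℕ) : ℝ) < ‖y‖) : bump n R y = 0 := by
  push_cast at h
  exact max_eq_left (by linarith)

lemma bump_lip (n R : ℕ) : LipschitzWith 1 (bump n R) := by
  have : LipschitzWith 1 (fun y : Fin n → ℝ => (R : ℝ) + 1 - ‖y‖) := by
    apply LipschitzWith.of_dist_le_mul
    intro x y
    rw [Real.dist_eq, dist_eq_norm]
    have := abs_norm_sub_norm_le x y
    have e : (R : ℝ) + 1 - ‖x‖ - (R + 1 - ‖y‖) = -(‖x‖ - ‖y‖) := by ring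
    rw [e, abs_neg]
    simpa using this
  exact this.const_max 0

/-- index-separated tuples -/
def sep {ι : Type*} (l : ℕ) (y : ι → ℕ) : Prop :=
  (∀ i, l < y i) ∧ ∀ i j, i ≠ j → (y i + l ≤ y j ∨ y j + l ≤ y i)

open Classical in
/-- the separated tuples in a box -/
noncomputable def SS (ι : Type*) [Fintype ι] (l N : ℕ) : Finset (ι → ℕ) :=
  (Fintype.piFinset fun _ : ι => Finset.Icc 1 N).filter (sep l)

lemma mem_SS {ι : Type*} [Fintype ι] {l N : ℕ} {y : ι → ℕ} :
    y ∈ SS ι l N ↔ (∀ i, 1 ≤ y i ∧ y i ≤ N) ∧ sep l y := by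
  classical
  simp [SS]

open Classical in
/-- the window of indices around `u` -/
noncomputable def win (a : ℕ → ℝ) (α : ℝ) (R N u : ℕ) : Finset ℕ :=
  (Finset.Icc 1 N).filter (fun v => (N : ℝ) * dist (th a α u) (th a α v) ≤ R)

lemma mem_win {a : ℕ → ℝ} {α : ℝ} {R N u v : ℕ} :
    v ∈ win a α R N u ↔ (1 ≤ v ∧ v ≤ N) ∧ (N : ℝ) * dist (th a α u) (th a α v) ≤ R := by
  simp [win]

lemma FF_bump_one {n R N : ℕ} (t : Fin (n+1) → UnitAddCircle)
    (h : ∀ i j, (N : ℝ) * dist (t i) (t j) ≤ R) : 1 ≤ FF (bump n R) N t := by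
  apply bump_one
  rw [pi_norm_le_iff_of_nonneg (by positivity)]
  intro i
  rw [norm_mul, Real.norm_eq_abs, Real.norm_eq_abs, abs_rep, abs_of_nonneg (Nat.cast_nonneg N)]
  have := h i.castSucc i.succ
  rwa [dist_eq_norm] at this

/-- weighted count of separated tuples of `L = m + 1` points in a window -/
noncomputable def LH (a : ℕ → ℝ) (m R l N : ℕ) (α : ℝ) : ℝ :=
  ∑ y ∈ SS (Fin (m+1)) l N, FF (bump m R) N (fun i => th a α (y i))

lemma LH_nonneg (a : ℕ → ℝ) (m R l N : ℕ) (α : ℝ) : 0 ≤ LH a m R l N α :=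
  Finset.sum_nonneg fun _ _ => bump_nonneg _ _ _

lemma win_card {a : ℕ → ℝ} {α : ℝ} {m R l N : ℕ} (hl : 1 ≤ l)
    (h : LH a m (2 * R) l N α < (l.descFactorial (m+1) : ℝ)) (u : ℕ) :
    (win a α R N u).card ≤ 2 * l ^ 2 := by
  classical
  by_contra hcon
  push Not at hcon
  set W := (win a α R N u).filter (fun v => l < v) with hW
  have hWc : l * l ≤ W.card := by
    have h1 := Finset.card_filter_add_card_filter_not (s := win a α R N u) (fun v => l < v)
    have h2 : ((win a α R N u).filter (fun v => ¬ l < v)).card ≤ l := by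
      have : (win a α R N u).filter (fun v => ¬ l < v) ⊆ Finset.Icc 1 l := by
        intro v hv
        rw [Finset.mem_filter, mem_win] at hv
        rw [Finset.mem_Icc]; omega
      simpa using Finset.card_le_card this
    have h3 : l ≤ l * l := Nat.le_mul_self l
    rw [← hW] at h1
    rw [pow_two] at hcon
    generalize l * l = z at *
    omega
  obtain ⟨r, _, hr⟩ := Finset.exists_le_card_fiber_of_mul_le_card_of_maps_to (s := W)
    (t := Finset.range l) (f := fun v => v % l) (n := l)
    (fun v _ => Finset.mem_range.2 (Nat.mod_lt _ hl)) ⟨0, Finset.mem_range.2 hl⟩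
    (by rwa [Finset.card_range])
  set W' := W.filter (fun v => v % l = r) with hW'
  have hmem : ∀ v ∈ W', (1 ≤ v ∧ v ≤ N) ∧ (N : ℝ) * dist (th a α u) (th a α v) ≤ R ∧ l < v ∧ v % l = r := by
    intro v hv
    rw [hW', Finset.mem_filter, hW, Finset.mem_filter, mem_win] at hv
    tauto
  let E : (Fin (m+1) ↪ W') → (Fin (m+1) → ℕ) := fun e i => (e i : ℕ)
  have hEinj : Function.Injective E := by
    intro e e' hee
    ext i
    exact congrFun hee i
  have hsub : Finset.univ.image E ⊆ SS (Fin (m+1)) l N := by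
    intro y hy
    obtain ⟨e, _, rfl⟩ := Finset.mem_image.1 hy
    rw [mem_SS]
    refine ⟨fun i => (hmem _ (e i).2).1, fun i => (hmem _ (e i).2).2.2.1, ?_⟩
    intro i j hij
    have hne : ((e i : W') : ℕ) ≠ (e j : ℕ) := fun hh => hij (e.injective (Subtype.ext hh))
    have h1 := (hmem _ (e i).2).2.2.2
    have h2 := (hmem _ (e j).2).2.2.2
    change (e i : ℕ) + l ≤ (e j : ℕ) ∨ (e j : ℕ) + l ≤ (e i : ℕ)
    have h3 := Nat.div_add_mod (e i : ℕ) l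
    have h4 := Nat.div_add_mod (e j : ℕ) l
    rw [h1] at h3
    rw [h2] at h4
    rcases lt_trichotomy ((e i : ℕ) / l) ((e j : ℕ) / l) with hlt | heq | hgt
    · left
      have : l * ((e i : ℕ) / l + 1) ≤ l * ((e j : ℕ) / l) := Nat.mul_le_mul_left _ hlt
      rw [mul_add, mul_one] at this
      omega
    · exfalso; apply hne; rw [← h3, ← h4, heq]
    · right
      have : l * ((e j : ℕ) / l + 1) ≤ l * ((e i : ℕ) / l) := Nat.mul_le_mul_left _ hgt
      rw [mul_add, mul_one] at this
      omega
  have hone : ∀ y ∈ Finset.univ.image E, (1 : ℝ) ≤ FF (bump m (2 * R)) N (fun i => th a α (y i)) := by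
    intro y hy
    obtain ⟨e, _, rfl⟩ := Finset.mem_image.1 hy
    apply FF_bump_one
    intro i j
    have h1 := (hmem _ (e i).2).2.1
    have h2 := (hmem _ (e j).2).2.1
    have h3 := dist_triangle_left (th a α (e i)) (th a α (e j)) (th a α u)
    have h4 := mul_le_mul_of_nonneg_left h3 (Nat.cast_nonneg (α := ℝ) N)
    push_cast
    change (N : ℝ) * dist (th a α (e i)) (th a α (e j)) ≤ _
    linarith
  have hcard : (Finset.univ.image E).card = W'.card.descFactorial (m+1) := by
    rw [Finset.card_image_of_injective _ hEinj, Finset.card_univ, Fintype.card_embedding_eq]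
    simp
  have : ((l.descFactorial (m+1) : ℕ) : ℝ) ≤ LH a m (2 * R) l N α := by
    calc ((l.descFactorial (m+1) : ℕ) : ℝ) ≤ ((Finset.univ.image E).card : ℝ) := by
          rw [hcard]
          exact_mod_cast Nat.descFactorial_le _ hr
      _ = ∑ y ∈ Finset.univ.image E, (1:ℝ) := by simp
      _ ≤ ∑ y ∈ Finset.univ.image E, FF (bump m (2 * R)) N (fun i => th a α (y i)) :=
          Finset.sum_le_sum hone
      _ ≤ _ := Finset.sum_le_sum_of_subset_of_nonneg hsub fun _ _ _ => bump_nonneg _ _ _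
  linarith

end LacPC


namespace LacPC

/-- lacunary -/
structure Lac (c : ℝ) (a : ℕ → ℝ) : Prop where
  one_lt : 1 < c
  pos : ∀ n ≥ 1, 0 < a n
  lac : ∀ n ≥ 1, c * a n ≤ a (n + 1)

lemma Lac.pow_le {c : ℝ} {a : ℕ → ℝ} (h : Lac c a) {u : ℕ} (hu : 1 ≤ u) (d : ℕ) :
    c ^ d * a u ≤ a (u + d) := by
  induction d with
  | zero => simp
  | succ d ih =>
    have h1 := h.lac (u + d) (by omega)
    have h2 := mul_le_mul_of_nonneg_left ih (zero_le_one.trans h.one_lt.le)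
    rw [← add_assoc, pow_succ]
    nlinarith

lemma Lac.mono {c : ℝ} {a : ℕ → ℝ} (h : Lac c a) {u v : ℕ} (hu : 1 ≤ u) (huv : u ≤ v) :
    a u ≤ a v := by
  obtain ⟨d, rfl⟩ := Nat.exists_eq_add_of_le huv
  refine le_trans ?_ (h.pow_le hu d)
  exact le_mul_of_one_le_left (h.pos u hu).le (one_le_pow₀ h.one_lt.le)

/-- constant -/
noncomputable def kap (c : ℝ) (a : ℕ → ℝ) : ℝ := min 1 (min (a 1) ((c - 1) * a 1))

/-- growth parameter -/
noncomputable def TT (c : ℝ) (a : ℕ → ℝ) (l : ℕ) : ℝ := kap c a * c ^ l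

lemma Lac.kap_pos {c : ℝ} {a : ℕ → ℝ} (h : Lac c a) : 0 < kap c a := by
  have h1 := h.pos 1 le_rfl
  have h2 := h.one_lt
  unfold kap
  refine lt_min one_pos (lt_min h1 (mul_pos (by linarith) h1))

lemma Lac.TT_pos {c : ℝ} {a : ℕ → ℝ} (h : Lac c a) (l : ℕ) : 0 < TT c a l :=
  mul_pos h.kap_pos (pow_pos (by linarith [h.one_lt]) _)

lemma Lac.big {c : ℝ} {a : ℕ → ℝ} (h : Lac c a) {l u : ℕ} (hu : l < u) : c ^ l * a 1 ≤ a u :=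
  (h.pow_le le_rfl l).trans (h.mono (by omega) (by omega))

lemma Lac.TT_le {c : ℝ} {a : ℕ → ℝ} (h : Lac c a) {l u : ℕ} (hu : l < u) : TT c a l ≤ a u := by
  refine le_trans ?_ (h.big hu)
  unfold TT
  rw [mul_comm]
  have : 0 ≤ c ^ l := pow_nonneg (by linarith [h.one_lt]) _
  gcongr
  exact (min_le_right _ _).trans (min_le_left _ _)

lemma Lac.TT_le_sub {c : ℝ} {a : ℕ → ℝ} (h : Lac c a) {l u v : ℕ} (hu : l < u) (huv : u < v) :
    TT c a l ≤ a v - a u := by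
  have h1 := h.big hu
  have h2 := h.lac u (by omega)
  have h3 := h.mono (u := u + 1) (v := v) (by omega) (by omega)
  have h4 := h.one_lt
  have h5 : TT c a l ≤ (c - 1) * (c ^ l * a 1) := by
    unfold TT
    have : 0 ≤ c ^ l := pow_nonneg (by linarith [h.one_lt]) _
    have h6 : kap c a ≤ (c - 1) * a 1 := (min_le_right _ _).trans (min_le_right _ _)
    nlinarith
  nlinarith

lemma Lac.TT_mul {c : ℝ} {a : ℕ → ℝ} (h : Lac c a) {l u v : ℕ} (hu : l < u) (huv : u + l ≤ v) :
    TT c a l * a u ≤ a v := by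
  refine le_trans ?_ ((h.pow_le (by omega) l).trans (h.mono (by omega) huv))
  have h1 := h.pos u (by omega)
  have h2 : TT c a l ≤ c ^ l := by
    unfold TT
    have : 0 ≤ c ^ l := pow_nonneg (by linarith [h.one_lt]) _
    exact mul_le_of_le_one_left this (min_le_left _ _)
  gcongr

lemma E_one {c : ℝ} {a : ℕ → ℝ} (h : Lac c a) {ι : Type*} [Fintype ι]
    {F : (ι → UnitAddCircle) → ℝ} {K : NNReal} (hF : LipschitzWith K F) {B : ℝ}
    (hB : ∀ t, |F t| ≤ B) {l : ℕ} (hT : 1 ≤ TT c a l) {y : ι → ℕ} (hy : sep l y) (A : ℝ) :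
    |(∫ α in Set.Ioc A (A+1), F (fun i => th a α (y i))) - ∫ U, F U|
      ≤ Fintype.card ι * ((K + 2 * B) / TT c a l) := by
  classical
  refine equi hF hB hT (fun i => a (y i)) (fun i => h.TT_le (hy.1 i)) ?_ A
  intro i j hij
  rcases hy.2 i j hij with h1 | h1
  · exact Or.inl (h.TT_mul (hy.1 i) h1)
  · exact Or.inr (h.TT_mul (hy.1 j) h1)

lemma cont_th (a : ℕ → ℝ) (j : ℕ) : Continuous (fun α => th a α j) :=
  (AddCircle.continuous_mk' 1).comp (continuous_id.mul continuous_const)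

/-- the standing assumptions on a test function -/
structure TF (n : ℕ) (f : (Fin n → ℝ) → ℝ) (ρ : ℕ) (Λ B : NNReal) : Prop where
  supp : ∀ y, (ρ : ℝ) < ‖y‖ → f y = 0
  lip : LipschitzWith Λ f
  bdd : ∀ y, |f y| ≤ B

lemma bump_TF (n R : ℕ) : TF n (bump n R) (R + 1) 1 (R + 1) :=
  ⟨bump_supp n R, bump_lip n R, by simpa using bump_le n R⟩

variable {n : ℕ} {f : (Fin n → ℝ) → ℝ} {ρ : ℕ} {Λ B : NNReal}

lemma FF_bdd (hf : TF n f ρ Λ B) (N : ℕ) (t) : |FF f N t| ≤ B := hf.bdd _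

lemma cont_FF (hf : TF n f ρ Λ B) {N : ℕ} (hN : 2 * ρ < N) (a : ℕ → ℝ) (y : Fin (n+1) → ℕ) :
    Continuous (fun α => FF f N (fun i => th a α (y i))) :=
  (FF_lip hf.supp hf.lip hN).continuous.comp (continuous_pi fun i => cont_th a (y i))

lemma E_FF {c : ℝ} {a : ℕ → ℝ} (h : Lac c a) (hf : TF n f ρ Λ B) {N l : ℕ} (hN : 2 * ρ < N)
    (hT : 1 ≤ TT c a l) {y : Fin (n+1) → ℕ} (hy : sep l y) (A : ℝ) :
    |(∫ α in Set.Ioc A (A+1), FF f N (fun i => th a α (y i))) - ((N:ℝ)^n)⁻¹ * ∫ y, f y|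
      ≤ ((n + 1) * (4 * Λ + 2 * B)) * (N / TT c a l) := by
  have h1 := E_one h (FF_lip hf.supp hf.lip hN) (FF_bdd hf N) hT hy A
  rw [FF_int hf.supp hf.lip hN] at h1
  refine h1.trans ?_
  have hN1 : (1:ℝ) ≤ N := by exact_mod_cast (by omega : 1 ≤ N)
  have hTp := h.TT_pos l
  rw [mul_div, mul_div]
  refine div_le_div_of_nonneg_right ?_ hTp.le
  simp only [Fintype.card_fin]
  push_cast
  have : (B:ℝ) ≤ B * N := le_mul_of_one_le_right B.2 hN1
  have hn : (0:ℝ) ≤ n := n.cast_nonneg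
  have h3 : (2 * (Λ:ℝ) * N * 2 + 2 * B) ≤ (4 * Λ + 2 * B) * N := by nlinarith
  calc ((n:ℝ) + 1) * (2 * (Λ:ℝ) * N * 2 + 2 * B) ≤ (n+1) * ((4 * Λ + 2 * B) * N) := by gcongr
    _ = _ := by ring

lemma pair_lip {k : ℕ} {G : (Fin k → UnitAddCircle) → ℝ} {K : NNReal} (hG : LipschitzWith K G)
    (hB : ∀ t, |G t| ≤ B) : LipschitzWith (2 * B * K)
      (fun t : Fin k ⊕ Fin k → UnitAddCircle => G (t ∘ Sum.inl) * G (t ∘ Sum.inr)) := by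
  apply LipschitzWith.of_dist_le_mul
  intro s t
  have h1 : dist (G (s ∘ Sum.inl)) (G (t ∘ Sum.inl)) ≤ K * dist s t :=
    (hG.dist_le_mul _ _).trans (by
      gcongr
      exact (dist_pi_le_iff dist_nonneg).2 fun i => dist_le_pi_dist s t (Sum.inl i))
  have h2 : dist (G (s ∘ Sum.inr)) (G (t ∘ Sum.inr)) ≤ K * dist s t :=
    (hG.dist_le_mul _ _).trans (by
      gcongr
      exact (dist_pi_le_iff dist_nonneg).2 fun i => dist_le_pi_dist s t (Sum.inr i))
  rw [Real.dist_eq] at h1 h2 ⊢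
  have e : G (s ∘ Sum.inl) * G (s ∘ Sum.inr) - G (t ∘ Sum.inl) * G (t ∘ Sum.inr)
      = G (s ∘ Sum.inl) * (G (s ∘ Sum.inr) - G (t ∘ Sum.inr)) +
        (G (s ∘ Sum.inl) - G (t ∘ Sum.inl)) * G (t ∘ Sum.inr) := by ring
  rw [e]
  refine (abs_add_le _ _).trans ?_
  rw [abs_mul, abs_mul]
  have h3 := mul_le_mul (hB (s ∘ Sum.inl)) h2 (abs_nonneg _) B.2
  have h4 := mul_le_mul h1 (hB (t ∘ Sum.inr)) (abs_nonneg _) ((abs_nonneg _).trans h1)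
  push_cast
  linarith

lemma pair_int {k : ℕ} (G : (Fin k → UnitAddCircle) → ℝ) :
    ∫ t : Fin k ⊕ Fin k → UnitAddCircle, G (t ∘ Sum.inl) * G (t ∘ Sum.inr) = (∫ t, G t) ^ 2 := by
  have h := volume_measurePreserving_sumPiEquivProdPi (fun _ : Fin k ⊕ Fin k => UnitAddCircle)
  have h2 := h.integral_comp (MeasurableEquiv.measurableEmbedding _)
    (fun z : (Fin k → UnitAddCircle) × (Fin k → UnitAddCircle) => G z.1 * G z.2)
  have h3 := integral_prod_mul (μ := (volume : Measure (Fin k → UnitAddCircle)))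
    (ν := (volume : Measure (Fin k → UnitAddCircle))) G G
  rw [pow_two, ← h3]
  exact h2

lemma E_pair {c : ℝ} {a : ℕ → ℝ} (h : Lac c a) (hf : TF n f ρ Λ B) {N l : ℕ} (hN : 2 * ρ < N)
    (hT : 1 ≤ TT c a l) {x y : Fin (n+1) → ℕ} (hy : sep l (Sum.elim x y)) (A : ℝ) :
    |(∫ α in Set.Ioc A (A+1), FF f N (fun i => th a α (x i)) * FF f N (fun i => th a α (y i)))
        - (((N:ℝ)^n)⁻¹ * ∫ y, f y) ^ 2|
      ≤ ((2 * (n + 1)) * (8 * B * Λ + 2 * B ^ 2)) * (N / TT c a l) := by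
  have hb : ∀ t : Fin (n+1) ⊕ Fin (n+1) → UnitAddCircle,
      |FF f N (t ∘ Sum.inl) * FF f N (t ∘ Sum.inr)| ≤ B * B := by
    intro t
    rw [abs_mul]
    exact mul_le_mul (FF_bdd hf N _) (FF_bdd hf N _) (abs_nonneg _) B.2
  have h1 := E_one h (pair_lip (FF_lip hf.supp hf.lip hN) (FF_bdd hf N)) hb hT hy A
  rw [pair_int, FF_int hf.supp hf.lip hN] at h1
  refine h1.trans ?_
  have hN1 : (1:ℝ) ≤ N := by exact_mod_cast (by omega : 1 ≤ N)
  have hTp := h.TT_pos l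
  rw [mul_div, mul_div]
  refine div_le_div_of_nonneg_right ?_ hTp.le
  simp only [Fintype.card_fin, Fintype.card_sum]
  push_cast
  have h4 : (B:ℝ)^2 ≤ B^2 * N := le_mul_of_one_le_right (by positivity) hN1
  have h3 : (2 * (B:ℝ) * (2 * (Λ:ℝ) * N * 2) + 2 * (B * B)) ≤ (8 * B * Λ + 2 * B ^ 2) * N := by nlinarith
  calc ((n:ℝ) + 1 + (n + 1)) * (2 * (B:ℝ) * (2 * (Λ:ℝ) * N * 2) + 2 * (B * B))
      ≤ (n + 1 + (n+1)) * ((8 * B * Λ + 2 * B ^ 2) * N) := by gcongr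
    _ = _ := by ring

end LacPC


namespace LacPC

variable {n : ℕ} {f : (Fin n → ℝ) → ℝ} {ρ : ℕ} {Λ B : NNReal}

lemma card_pi_win {a : ℕ → ℝ} {α : ℝ} {R N W : ℕ} (hW : ∀ u, (win a α R N u).card ≤ W)
    (k u : ℕ) : (Fintype.piFinset fun _ : Fin k => win a α R N u).card ≤ W ^ k := by
  rw [Fintype.card_piFinset]
  calc ∏ _i : Fin k, (win a α R N u).card ≤ ∏ _i : Fin k, W := Finset.prod_le_prod' fun _ _ => hW u
    _ = W ^ k := by simp

lemma count_U {a : ℕ → ℝ} {α : ℝ} {R N W k : ℕ} (hW : ∀ u, (win a α R N u).card ≤ W)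
    (U : Finset ℕ) (S : Finset (Fin k → ℕ))
    (hS : ∀ x ∈ S, (∀ i, 1 ≤ x i ∧ x i ≤ N) ∧ (∃ i, x i ∈ U) ∧
      ∀ i j, (N : ℝ) * dist (th a α (x i)) (th a α (x j)) ≤ R) :
    S.card ≤ U.card * W ^ k := by
  classical
  have hsub : S ⊆ U.biUnion (fun u => Fintype.piFinset fun _ : Fin k => win a α R N u) := by
    intro x hx
    obtain ⟨h1, ⟨i, hi⟩, h3⟩ := hS x hx
    rw [Finset.mem_biUnion]
    refine ⟨x i, hi, ?_⟩
    rw [Fintype.mem_piFinset]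
    intro j
    rw [mem_win]
    exact ⟨h1 j, h3 i j⟩
  exact (Finset.card_le_card hsub).trans
    (Finset.card_biUnion_le_card_mul _ _ _ fun u _ => card_pi_win hW k u)

/-- jointly separated pairs -/
def JS {k : ℕ} (l : ℕ) (p : (Fin k → ℕ) × (Fin k → ℕ)) : Prop := sep l (Sum.elim p.1 p.2)

lemma count_pairs {a : ℕ → ℝ} {α : ℝ} {R N W k l : ℕ} (hW : ∀ u, (win a α R N u).card ≤ W)
    (S : Finset ((Fin k → ℕ) × (Fin k → ℕ)))
    (hS : ∀ p ∈ S, p.1 ∈ SS (Fin k) l N ∧ p.2 ∈ SS (Fin k) l N ∧ ¬ JS l p ∧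
      (∀ i j, (N : ℝ) * dist (th a α (p.1 i)) (th a α (p.1 j)) ≤ R) ∧
      (∀ i j, (N : ℝ) * dist (th a α (p.2 i)) (th a α (p.2 j)) ≤ R)) :
    S.card ≤ N * ((2 * l + 1) * (W ^ k * W ^ k)) := by
  classical
  have hsub : S ⊆ (Finset.Icc 1 N).biUnion (fun u => (Finset.Icc (u - l) (u + l)).biUnion fun v =>
      (Fintype.piFinset fun _ : Fin k => win a α R N u) ×ˢ
      (Fintype.piFinset fun _ : Fin k => win a α R N v)) := by
    intro p hp
    obtain ⟨h1, h2, h3, h4, h5⟩ := hS p hp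
    rw [mem_SS] at h1 h2
    have : ∃ i j, ¬ (p.1 i + l ≤ p.2 j ∨ p.2 j + l ≤ p.1 i) := by
      by_contra hcon
      push Not at hcon
      apply h3
      refine ⟨?_, ?_⟩
      · rintro (i | i)
        · exact h1.2.1 i
        · exact h2.2.1 i
      · rintro (i | i) (j | j) hij
        · exact h1.2.2 i j (fun h => hij (by rw [h]))
        · exact hcon i j
        · exact (hcon j i).symm
        · exact h2.2.2 i j (fun h => hij (by rw [h]))
    obtain ⟨i, j, hij⟩ := this
    rw [Finset.mem_biUnion]
    refine ⟨p.1 i, Finset.mem_Icc.2 (h1.1 i), ?_⟩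
    rw [Finset.mem_biUnion]
    refine ⟨p.2 j, Finset.mem_Icc.2 (by omega), ?_⟩
    rw [Finset.mem_product, Fintype.mem_piFinset, Fintype.mem_piFinset]
    exact ⟨fun q => mem_win.2 ⟨h1.1 q, h4 i q⟩, fun q => mem_win.2 ⟨h2.1 q, h5 j q⟩⟩
  refine (Finset.card_le_card hsub).trans ?_
  refine (Finset.card_biUnion_le_card_mul _ _ ((2 * l + 1) * (W ^ k * W ^ k)) ?_).trans (by simp)
  intro u _
  refine (Finset.card_biUnion_le_card_mul _ _ (W ^ k * W ^ k) ?_).trans ?_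
  · intro v _
    rw [Finset.card_product]
    exact Nat.mul_le_mul (card_pi_win hW k u) (card_pi_win hW k v)
  · apply Nat.mul_le_mul_right
    rw [Nat.card_Icc]; omega

lemma hit_FF (hf : TF n f ρ Λ B) {R N : ℕ} (hR : 2 * n * ρ ≤ R)
    (t : Fin (n+1) → UnitAddCircle) (h : FF f N t ≠ 0) (i j : Fin (n+1)) :
    (N : ℝ) * dist (t i) (t j) ≤ R := by
  refine (hit_all (Nat.cast_nonneg ρ) t (hit_of_ne hf.supp t h) i j).trans ?_
  exact_mod_cast hR

open Classical in
lemma sum_pairs (hf : TF n f ρ Λ B) {a : ℕ → ℝ} {α : ℝ} {R N W l : ℕ} (hR : 2 * n * ρ ≤ R)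
    (hW : ∀ u, (win a α R N u).card ≤ W) :
    ∑ p ∈ (SS (Fin (n+1)) l N ×ˢ SS (Fin (n+1)) l N).filter (fun p => ¬ JS l p),
      |FF f N (fun i => th a α (p.1 i)) * FF f N (fun i => th a α (p.2 i))|
    ≤ B ^ 2 * (N * ((2 * l + 1) * (W ^ (n+1) * W ^ (n+1)))) := by
  classical
  set P := (SS (Fin (n+1)) l N ×ˢ SS (Fin (n+1)) l N).filter (fun p => ¬ JS l p) with hP
  set g := fun p : (Fin (n+1) → ℕ) × (Fin (n+1) → ℕ) =>
    |FF f N (fun i => th a α (p.1 i)) * FF f N (fun i => th a α (p.2 i))| with hg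
  rw [← Finset.sum_filter_ne_zero]
  have hc := count_pairs (l := l) hW (P.filter (fun p => g p ≠ 0)) (by
    intro p hp
    rw [Finset.mem_filter, hP, Finset.mem_filter, Finset.mem_product] at hp
    obtain ⟨⟨⟨h1, h2⟩, h3⟩, h4⟩ := hp
    have h4' := mul_ne_zero_iff.1 (abs_ne_zero.1 h4)
    exact ⟨h1, h2, h3, fun i j => hit_FF hf hR _ h4'.1 i j, fun i j => hit_FF hf hR _ h4'.2 i j⟩)
  have hc' : ((P.filter (fun p => g p ≠ 0)).card : ℝ)
      ≤ (N * ((2 * l + 1) * (W ^ (n+1) * W ^ (n+1)))) := by exact_mod_cast hc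
  calc ∑ p ∈ P.filter (fun p => g p ≠ 0), g p ≤ ∑ p ∈ P.filter (fun p => g p ≠ 0), (B:ℝ)^2 := by
        apply Finset.sum_le_sum
        intro p _
        simp only [hg]
        rw [abs_mul, pow_two]
        exact mul_le_mul (FF_bdd hf N _) (FF_bdd hf N _) (abs_nonneg _) B.2
    _ = (P.filter (fun p => g p ≠ 0)).card * (B:ℝ)^2 := by simp
    _ ≤ _ := by rw [mul_comm]; gcongr

/-- general bound for sums over hitting tuples meeting `U` -/
lemma sum_U {g : (Fin (n+1) → ℕ) → ℝ} {b : ℝ} (hb : 0 ≤ b) {a : ℕ → ℝ} {α : ℝ} {R N W : ℕ}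
    (hW : ∀ u, (win a α R N u).card ≤ W) (U : Finset ℕ) (S : Finset (Fin (n+1) → ℕ))
    (hS : ∀ x ∈ S, (∀ i, 1 ≤ x i ∧ x i ≤ N) ∧ |g x| ≤ b ∧ (g x ≠ 0 → (∃ i, x i ∈ U) ∧
      ∀ i j, (N : ℝ) * dist (th a α (x i)) (th a α (x j)) ≤ R)) :
    |∑ x ∈ S, g x| ≤ b * (U.card * W ^ (n+1)) := by
  classical
  rw [← Finset.sum_filter_ne_zero]
  have hc := count_U hW U (S.filter (fun x => g x ≠ 0)) (by
    intro x hx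
    rw [Finset.mem_filter] at hx
    obtain ⟨h1, h2, h3⟩ := hS x hx.1
    exact ⟨h1, (h3 hx.2).1, (h3 hx.2).2⟩)
  have hc' : ((S.filter (fun x => g x ≠ 0)).card : ℝ) ≤ U.card * W ^ (n+1) := by exact_mod_cast hc
  refine (Finset.abs_sum_le_sum_abs _ _).trans ?_
  calc ∑ x ∈ S.filter (fun x => g x ≠ 0), |g x| ≤ ∑ x ∈ S.filter (fun x => g x ≠ 0), b := by
        apply Finset.sum_le_sum
        intro x hx
        exact (hS x (Finset.mem_filter.1 hx).1).2.1
    _ = (S.filter (fun x => g x ≠ 0)).card * b := by simp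
    _ ≤ _ := by rw [mul_comm]; gcongr

lemma card_SS_le (k l N : ℕ) : (SS (Fin k) l N).card ≤ N ^ k := by
  classical
  refine (Finset.card_filter_le _ _).trans ?_
  simp

lemma card_update (k N w : ℕ) (i : Fin (k+1)) (V : Finset ℕ) (hV : V.card ≤ w) :
    (Fintype.piFinset (Function.update (fun _ : Fin (k+1) => Finset.Icc 1 N) i V)).card
      ≤ w * N ^ k := by
  rw [Fintype.card_piFinset]
  have : (fun j => (Function.update (fun _ : Fin (k+1) => Finset.Icc 1 N) i V j).card)
      = Function.update (fun _ : Fin (k+1) => N) i V.card := by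
    ext j
    by_cases h : j = i
    · subst h; simp
    · simp [h]
  rw [this, Finset.prod_update_of_mem (Finset.mem_univ i)]
  simp only [Finset.prod_const]
  rw [Finset.card_sdiff_of_subset (by simp)]
  simpa using Nat.mul_le_mul_right _ hV

lemma card_SS_ge (k l N : ℕ) :
    N ^ (k+1) ≤ (SS (Fin (k+1)) l N).card + ((k+1) + (k+1) ^ 2) * ((2 * l + 1) * N ^ k) := by
  classical
  set P := Fintype.piFinset fun _ : Fin (k+1) => Finset.Icc 1 N with hP
  have hPc : P.card = N ^ (k+1) := by simp [hP]
  set X1 : Finset (Fin (k+1) → ℕ) := Finset.univ.biUnion fun i : Fin (k+1) =>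
    P.filter (fun x => x i ≤ l) with hX1
  set X2 : Finset (Fin (k+1) → ℕ) := Finset.univ.biUnion fun q : Fin (k+1) × Fin (k+1) =>
    P.filter (fun x => q.1 ≠ q.2 ∧ x q.1 < x q.2 + l ∧ x q.2 < x q.1 + l) with hX2
  have hsub : P ⊆ SS (Fin (k+1)) l N ∪ (X1 ∪ X2) := by
    intro x hx
    by_cases hs : sep l x
    · refine Finset.mem_union_left _ (mem_SS.2 ⟨fun i => ?_, hs⟩)
      rw [hP, Fintype.mem_piFinset] at hx
      exact Finset.mem_Icc.1 (hx i)
    · apply Finset.mem_union_right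
      simp only [sep, not_and_or] at hs
      rcases hs with hs | hs
      · push Not at hs
        obtain ⟨i, hi⟩ := hs
        exact Finset.mem_union_left _ (Finset.mem_biUnion.2 ⟨i, Finset.mem_univ _,
          Finset.mem_filter.2 ⟨hx, hi⟩⟩)
      · push Not at hs
        obtain ⟨i, j, hij, h1, h2⟩ := hs
        exact Finset.mem_union_right _ (Finset.mem_biUnion.2 ⟨(i, j), Finset.mem_univ _,
          Finset.mem_filter.2 ⟨hx, hij, h2, h1⟩⟩)
  have h1 : X1.card ≤ (k+1) * ((2 * l + 1) * N ^ k) := by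
    refine (Finset.card_biUnion_le_card_mul _ _ ((2 * l + 1) * N ^ k) ?_).trans (by simp)
    intro i _
    refine le_trans (Finset.card_le_card ?_) (card_update k N _ i (Finset.range (2*l+1)) (by simp))
    intro x hx
    rw [Finset.mem_filter, hP, Fintype.mem_piFinset] at hx
    rw [Fintype.mem_piFinset]
    intro j
    by_cases h : j = i
    · subst h
      simp only [Function.update_self, Finset.mem_range]
      omega
    · simpa [h] using hx.1 j
  have h2 : X2.card ≤ (k+1)^2 * ((2 * l + 1) * N ^ k) := by
    refine (Finset.card_biUnion_le_card_mul _ _ ((2 * l + 1) * N ^ k) ?_).trans (by simp [pow_two])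
    rintro ⟨i, j⟩ _
    refine le_trans ?_ (card_update k N _ i (Finset.range (2*l+1)) (by simp))
    refine Finset.card_le_card_of_injOn (fun x => Function.update x i (x i + l - x j)) ?_ ?_
    · intro x hx
      rw [Finset.mem_coe, Finset.mem_filter, hP, Fintype.mem_piFinset] at hx
      rw [Finset.mem_coe, Fintype.mem_piFinset]
      intro q
      by_cases h : q = i
      · subst h
        have h5 : x q < x j + l ∧ x j < x q + l := hx.2.2
        simp only [Function.update_self, Finset.mem_range]
        omega
      · simpa [h] using hx.1 q
    · intro x hx y hy hxy
      rw [Finset.mem_coe, Finset.mem_filter] at hx hy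
      have hne : ∀ q, q ≠ i → x q = y q := by
        intro q hq
        simpa [hq] using congrFun hxy q
      have hi := congrFun hxy i
      simp only [Function.update_self] at hi
      have hj := hne j (Ne.symm hx.2.1)
      ext q
      by_cases h : q = i
      · subst h
        have h5 : x q < x j + l ∧ x j < x q + l := hx.2.2
        have h6 : y q < y j + l ∧ y j < y q + l := hy.2.2
        omega
      · exact hne q h
  have h3 := (Finset.card_le_card hsub).trans ((Finset.card_union_le _ _).trans
    (Nat.add_le_add_left (Finset.card_union_le _ _) _))
  rw [hPc] at h3
  nlinarith

end LacPC


namespace LacPC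

variable {n : ℕ} {f : (Fin n → ℝ) → ℝ} {ρ : ℕ} {Λ B : NNReal}

lemma cont_LH (a : ℕ → ℝ) (m R l N : ℕ) (hN : 2 * (R + 1) < N) : Continuous (LH a m R l N) := by
  unfold LH
  exact continuous_finsetSum _ fun y _ => cont_FF (bump_TF m R) hN a y

lemma sum_E_FF {c : ℝ} {a : ℕ → ℝ} (h : Lac c a) (hf : TF n f ρ Λ B) {N l : ℕ} (hN : 2 * ρ < N)
    (hT : 1 ≤ TT c a l) (A : ℝ) :
    |∑ y ∈ SS (Fin (n+1)) l N, (∫ α in Set.Ioc A (A+1), FF f N (fun i => th a α (y i)))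
      - (SS (Fin (n+1)) l N).card * (((N:ℝ)^n)⁻¹ * ∫ y, f y)|
      ≤ N ^ (n+1) * (((n + 1) * (4 * Λ + 2 * B)) * (N / TT c a l)) := by
  have e : (SS (Fin (n+1)) l N).card * (((N:ℝ)^n)⁻¹ * ∫ y, f y)
      = ∑ y ∈ SS (Fin (n+1)) l N, (((N:ℝ)^n)⁻¹ * ∫ y, f y) := by simp
  rw [e, ← Finset.sum_sub_distrib]
  refine (Finset.abs_sum_le_sum_abs _ _).trans ?_
  have hTp := h.TT_pos l
  calc _ ≤ ∑ y ∈ SS (Fin (n+1)) l N, (((n + 1) * (4 * Λ + 2 * B)) * ((N:ℝ) / TT c a l)) :=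
        Finset.sum_le_sum fun y hy => E_FF h hf hN hT (mem_SS.1 hy).2 A
    _ = (SS (Fin (n+1)) l N).card * (((n + 1) * (4 * Λ + 2 * B)) * ((N:ℝ) / TT c a l)) := by simp
    _ ≤ _ := by
      gcongr
      exact_mod_cast card_SS_le (n+1) l N

lemma E_LH {c : ℝ} {a : ℕ → ℝ} (h : Lac c a) {m R N l : ℕ} (hN : 2 * (R + 1) < N)
    (hT : 1 ≤ TT c a l) (A : ℝ) :
    ∫ α in Set.Ioc A (A+1), LH a m R l N α ≤ N * (∫ y, bump m R y) +
      N ^ (m+1) * (((m + 1) * (4 * 1 + 2 * (R + 1))) * (N / TT c a l)) := by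
  have h1 := sum_E_FF h (bump_TF m R) hN hT A
  unfold LH
  rw [integral_finsetSum _ fun y _ => (cont_FF (bump_TF m R) hN a y).integrableOn_Ioc]
  have h2 := (abs_le.1 h1).2
  have h3 : (0:ℝ) ≤ ∫ y, bump m R y := integral_nonneg fun y => bump_nonneg m R y
  have hN0 : (0:ℝ) < N := by exact_mod_cast (by omega : 0 < N)
  have h4 : ((SS (Fin (m+1)) l N).card : ℝ) * (((N:ℝ)^m)⁻¹ * ∫ y, bump m R y)
      ≤ N * ∫ y, bump m R y := by
    have : ((SS (Fin (m+1)) l N).card : ℝ) ≤ N ^ (m+1) := by exact_mod_cast card_SS_le (m+1) l N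
    calc _ ≤ (N:ℝ)^(m+1) * (((N:ℝ)^m)⁻¹ * ∫ y, bump m R y) := by gcongr
      _ = _ := by field_simp; ring
  push_cast at h2
  linarith

/-- main normalised sum over separated tuples -/
noncomputable def YY (f : (Fin n → ℝ) → ℝ) (a : ℕ → ℝ) (l N : ℕ) (α : ℝ) : ℝ :=
  (1 / (N : ℝ)) * ∑ x ∈ SS (Fin (n+1)) l N, FF f N (fun i => th a α (x i))

lemma cont_YY (hf : TF n f ρ Λ B) {N : ℕ} (hN : 2 * ρ < N) (a : ℕ → ℝ) (l : ℕ) :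
    Continuous (YY f a l N) := by
  unfold YY
  exact continuous_const.mul (continuous_finsetSum _ fun y _ => cont_FF hf hN a y)

theorem variance {c : ℝ} {a : ℕ → ℝ} (h : Lac c a) (hf : TF n f ρ Λ B) {N l R W : ℕ}
    (hN : 2 * ρ < N) (hT : 1 ≤ TT c a l) (hR : 2 * n * ρ ≤ R) (qG : ℝ → ℝ) (hq : Continuous qG)
    (hq0 : ∀ α, 0 ≤ qG α) (hqW : ∀ α, qG α < 1 → ∀ u, (win a α R N u).card ≤ W) (A : ℝ) :
    ∫ α in Set.Ioc A (A+1), (YY f a l N α - ∫ y, f y) ^ 2 ≤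
      (∫ y, f y) ^ 2 * (1 - (SS (Fin (n+1)) l N).card / N ^ (n+1)) ^ 2 +
      (1 / N ^ 2) * (N ^ (2 * (n+1)) * (((2 * (n + 1)) * (8 * B * Λ + 2 * B ^ 2)) * (N / TT c a l))
        + B ^ 2 * (N * ((2 * l + 1) * (W ^ (n+1) * W ^ (n+1)))
        + N ^ (2 * (n+1)) * ∫ α in Set.Ioc A (A+1), qG α)) +
      (2 * |∫ y, f y| / N) * (N ^ (n+1) * (((n + 1) * (4 * Λ + 2 * B)) * (N / TT c a l))) := by
  classical
  set I := ∫ y, f y with hI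
  set S := SS (Fin (n+1)) l N with hS
  set g : (Fin (n+1) → ℕ) → ℝ → ℝ := fun x α => FF f N (fun i => th a α (x i)) with hg
  have hgc : ∀ x, Continuous (g x) := fun x => cont_FF hf hN a x
  set P := (S ×ˢ S).filter (fun p => JS l p) with hP
  set P' := (S ×ˢ S).filter (fun p => ¬ JS l p) with hP'
  have hN0 : (0:ℝ) < N := by exact_mod_cast (by omega : 0 < N)
  have hTp := h.TT_pos l
  have hScard : (S.card : ℝ) ≤ N ^ (n+1) := by exact_mod_cast card_SS_le (n+1) l N
  have hSScard : ((S ×ˢ S).card : ℝ) ≤ N ^ (2 * (n+1)) := by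
    rw [Finset.card_product]
    push_cast
    rw [two_mul, pow_add]
    gcongr
  have hPcard : (P.card : ℝ) ≤ (S.card : ℝ) ^ 2 := by
    rw [pow_two]
    have := Finset.card_filter_le (S ×ˢ S) (fun p => JS l p)
    rw [Finset.card_product] at this
    exact_mod_cast this
  have hPcard2 : (P.card : ℝ) ≤ N ^ (2 * (n+1)) :=
    le_trans (by exact_mod_cast Finset.card_filter_le _ _) hSScard
  have hP'card : (P'.card : ℝ) ≤ N ^ (2 * (n+1)) :=
    le_trans (by exact_mod_cast Finset.card_filter_le _ _) hSScard
  set D : ℝ := N * ((2 * l + 1) * (W ^ (n+1) * W ^ (n+1))) with hD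
  have hD0 : 0 ≤ D := by positivity
  have hnon : ∀ α, ∑ p ∈ P', g p.1 α * g p.2 α ≤ B ^ 2 * (D + N ^ (2 * (n+1)) * qG α) := by
    intro α
    by_cases hα : qG α < 1
    · have h1 := sum_pairs (l := l) hf hR (hqW α hα)
      have h2 : ∑ p ∈ P', g p.1 α * g p.2 α ≤ B ^ 2 * D :=
        (Finset.sum_le_sum fun p _ => le_abs_self _).trans h1
      have h3 : 0 ≤ (N:ℝ) ^ (2 * (n+1)) * qG α := mul_nonneg (by positivity) (hq0 α)
      refine h2.trans ?_
      gcongr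
      linarith
    · push Not at hα
      calc ∑ p ∈ P', g p.1 α * g p.2 α ≤ ∑ p ∈ P', (B:ℝ)^2 := by
            apply Finset.sum_le_sum
            intro p _
            refine (le_abs_self _).trans ?_
            rw [abs_mul, pow_two]
            exact mul_le_mul (FF_bdd hf N _) (FF_bdd hf N _) (abs_nonneg _) B.2
        _ = (B:ℝ)^2 * P'.card := by simp [mul_comm]
        _ ≤ (B:ℝ)^2 * (D + N ^ (2 * (n+1)) * qG α) := by
            have : (N:ℝ) ^ (2 * (n+1)) ≤ N ^ (2 * (n+1)) * qG α :=
              le_mul_of_one_le_right (by positivity) hα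
            gcongr
            linarith
  have hpt : ∀ α, (YY f a l N α - I) ^ 2 ≤ (1 / (N:ℝ) ^ 2) * ((∑ p ∈ P, g p.1 α * g p.2 α) +
      B ^ 2 * (D + N ^ (2 * (n+1)) * qG α)) + ((-(2 * I / N)) * (∑ x ∈ S, g x α) + I ^ 2) := by
    intro α
    have e1 : YY f a l N α = (1 / (N : ℝ)) * ∑ x ∈ S, g x α := rfl
    have e2 : (∑ x ∈ S, g x α) ^ 2 = (∑ p ∈ P, g p.1 α * g p.2 α) + ∑ p ∈ P', g p.1 α * g p.2 α := by
      rw [hP, hP', Finset.sum_filter_add_sum_filter_not, pow_two, Finset.sum_mul_sum,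
        Finset.sum_product]
    have e3 : (YY f a l N α - I) ^ 2 = (1 / (N:ℝ) ^ 2) * (∑ x ∈ S, g x α) ^ 2 +
        ((-(2 * I / N)) * (∑ x ∈ S, g x α) + I ^ 2) := by
      rw [e1]; field_simp; ring
    rw [e3, e2]
    have := hnon α
    gcongr
  set V := (volume : Measure ℝ).restrict (Set.Ioc A (A+1)) with hV
  have hinteg : ∀ G : ℝ → ℝ, Continuous G → Integrable G V := fun G hG => hG.integrableOn_Ioc
  have hone : ∀ r : ℝ, ∫ _α, r ∂V = r := by
    intro r
    rw [integral_const, measureReal_def, hV]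
    simp
  have hcP : Continuous (fun α => ∑ p ∈ P, g p.1 α * g p.2 α) :=
    continuous_finsetSum _ fun p _ => (hgc _).mul (hgc _)
  have hcS : Continuous (fun α => ∑ x ∈ S, g x α) := continuous_finsetSum _ fun x _ => hgc _
  have hmono := integral_mono (μ := V) (f := fun α => (YY f a l N α - I) ^ 2)
    (g := fun α => (1 / (N:ℝ) ^ 2) * ((∑ p ∈ P, g p.1 α * g p.2 α) +
      B ^ 2 * (D + N ^ (2 * (n+1)) * qG α)) + ((-(2 * I / N)) * (∑ x ∈ S, g x α) + I ^ 2))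
    (hinteg _ (((cont_YY hf hN a l).sub continuous_const).pow 2))
    (hinteg _ (by fun_prop)) hpt
  refine hmono.trans ?_
  clear_value D
  have hint2 : ∫ α, ((1 / (N:ℝ) ^ 2) * ((∑ p ∈ P, g p.1 α * g p.2 α) +
      B ^ 2 * (D + N ^ (2 * (n+1)) * qG α)) + ((-(2 * I / N)) * (∑ x ∈ S, g x α) + I ^ 2)) ∂V
      = (1 / (N:ℝ) ^ 2) * ((∑ p ∈ P, ∫ α, g p.1 α * g p.2 α ∂V) +
      B ^ 2 * (D + N ^ (2 * (n+1)) * ∫ α, qG α ∂V)) +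
      ((-(2 * I / N)) * (∑ x ∈ S, ∫ α, g x α ∂V) + I ^ 2) := by
    rw [integral_add (hinteg _ (by fun_prop)) (hinteg _ (by fun_prop)), integral_const_mul,
      integral_add (hinteg _ (by fun_prop)) (hinteg _ (by fun_prop)), integral_const_mul,
      integral_add (hinteg _ (by fun_prop)) (hinteg _ (by fun_prop)), integral_const_mul,
      integral_add (hinteg _ (by fun_prop)) (hinteg _ (by fun_prop)), integral_const_mul,
      integral_finsetSum (f := fun p α => g p.1 α * g p.2 α) P
        (fun p _ => hinteg _ ((hgc p.1).mul (hgc p.2))),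
      integral_finsetSum _ (fun p _ => hinteg _ (hgc _)), hone, hone]
  rw [hint2]
  set e0 := ((N:ℝ)^n)⁻¹ * I with he0
  set ε1 := N ^ (n+1) * (((n + 1) * (4 * Λ + 2 * B)) * (N / TT c a l)) with hε1
  set ε2 := ((2 * (n + 1)) * (8 * B * Λ + 2 * B ^ 2)) * (N / TT c a l) with hε2
  have hε20 : 0 ≤ ε2 := by positivity
  have hsum1 : |(∑ x ∈ S, ∫ α, g x α ∂V) - S.card * e0| ≤ ε1 := sum_E_FF h hf hN hT A
  have hsum2 : ∑ p ∈ P, ∫ α, g p.1 α * g p.2 α ∂V ≤ (S.card : ℝ) ^ 2 * e0 ^ 2 + N ^ (2 * (n+1)) * ε2 := by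
    calc ∑ p ∈ P, ∫ α, g p.1 α * g p.2 α ∂V ≤ ∑ p ∈ P, (e0 ^ 2 + ε2) := by
          apply Finset.sum_le_sum
          intro p hp
          have h1 := E_pair h hf hN hT (x := p.1) (y := p.2) (Finset.mem_filter.1 hp).2 A
          have h2 := (abs_le.1 h1).2
          change _ - e0 ^ 2 ≤ ε2 at h2
          linarith
      _ = P.card * e0 ^ 2 + P.card * ε2 := by simp
      _ ≤ _ := by gcongr
  have hsum1' : (-(2 * I / N)) * (∑ x ∈ S, ∫ α, g x α ∂V) ≤
      (-(2 * I / N)) * (S.card * e0) + (2 * |I| / N) * ε1 := by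
    have e : (-(2 * I / N)) * (∑ x ∈ S, ∫ α, g x α ∂V) = (-(2 * I / N)) * (S.card * e0)
      + (-(2 * I / N)) * ((∑ x ∈ S, ∫ α, g x α ∂V) - S.card * e0) := by ring
    rw [e]
    refine add_le_add le_rfl ?_
    refine (le_abs_self _).trans ?_
    rw [abs_mul, abs_neg, abs_div, abs_mul, abs_two, abs_of_pos hN0]
    gcongr
  have hfin : (1 / (N:ℝ) ^ 2) * ((S.card : ℝ) ^ 2 * e0 ^ 2) + ((-(2 * I / N)) * (S.card * e0) + I ^ 2)
      = I ^ 2 * (1 - S.card / N ^ (n+1)) ^ 2 := by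
    rw [he0]; field_simp; ring
  have hs3 : (1 / (N:ℝ) ^ 2) * ((∑ p ∈ P, ∫ α, g p.1 α * g p.2 α ∂V) +
      B ^ 2 * (D + N ^ (2 * (n+1)) * ∫ α, qG α ∂V)) ≤
      (1 / (N:ℝ) ^ 2) * (((S.card : ℝ) ^ 2 * e0 ^ 2 + N ^ (2 * (n+1)) * ε2) +
      B ^ 2 * (D + N ^ (2 * (n+1)) * ∫ α, qG α ∂V)) := by gcongr
  rw [← hfin]
  have e5 : (1 / (N:ℝ) ^ 2) * (((S.card : ℝ) ^ 2 * e0 ^ 2 + N ^ (2 * (n+1)) * ε2) +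
      B ^ 2 * (D + N ^ (2 * (n+1)) * ∫ α, qG α ∂V)) = (1 / (N:ℝ) ^ 2) * ((S.card : ℝ) ^ 2 * e0 ^ 2)
      + (1 / (N:ℝ) ^ 2) * (N ^ (2 * (n+1)) * ε2 +
      B ^ 2 * (D + N ^ (2 * (n+1)) * ∫ α, qG α ∂V)) := by ring
  linarith

end LacPC


namespace LacPC

variable {n : ℕ} {f : (Fin n → ℝ) → ℝ} {ρ : ℕ} {Λ B : NNReal}

/-- close pairs -/
def CP (l N : ℕ) : Finset (ℕ × ℕ) :=
  (Finset.Icc 1 N ×ˢ Finset.Icc 1 N).filter (fun p => l < p.1 ∧ p.1 < p.2 ∧ p.2 < p.1 + l)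

lemma mem_CP {l N : ℕ} {p : ℕ × ℕ} : p ∈ CP l N ↔
    ((1 ≤ p.1 ∧ p.1 ≤ N) ∧ (1 ≤ p.2 ∧ p.2 ≤ N)) ∧ l < p.1 ∧ p.1 < p.2 ∧ p.2 < p.1 + l := by
  simp [CP]

lemma card_CP (l N : ℕ) : (CP l N).card ≤ N * l := by
  have : (CP l N).card ≤ (Finset.Icc 1 N ×ˢ Finset.range l).card := by
    refine Finset.card_le_card_of_injOn (fun p => (p.1, p.2 - p.1)) ?_ ?_
    · intro p hp
      have := mem_CP.1 hp
      rw [Finset.mem_coe, Finset.mem_product, Finset.mem_Icc, Finset.mem_range]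
      dsimp only
      omega
    · rintro ⟨u, v⟩ hp ⟨u', v'⟩ hp' he
      have h1 := mem_CP.1 hp
      have h2 := mem_CP.1 hp'
      simp only [Prod.mk.injEq] at he h1 h2 ⊢
      omega
  simpa using this

/-- weighted number of close pairs whose points are close on the circle -/
noncomputable def CH (a : ℕ → ℝ) (R l N : ℕ) (α : ℝ) : ℝ :=
  ∑ p ∈ CP l N, HH (bump 1 R) N (fun _ => th a α p.2 - th a α p.1)

lemma CH_nonneg (a : ℕ → ℝ) (R l N : ℕ) (α : ℝ) : 0 ≤ CH a R l N α :=
  Finset.sum_nonneg fun _ _ => bump_nonneg _ _ _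

lemma cont_CH1 (a : ℕ → ℝ) {R N : ℕ} (hN : 2 * (R + 1) < N) (p : ℕ × ℕ) :
    Continuous (fun α => HH (bump 1 R) N (fun _ => th a α p.2 - th a α p.1)) :=
  (HH_lip (bump_supp 1 R) (bump_lip 1 R) hN).continuous.comp
    (continuous_pi fun _ => (cont_th a _).sub (cont_th a _))

lemma cont_CH (a : ℕ → ℝ) {R l N : ℕ} (hN : 2 * (R + 1) < N) : Continuous (CH a R l N) := by
  unfold CH
  exact continuous_finsetSum _ fun p _ => cont_CH1 a hN p

lemma E_CH {c : ℝ} {a : ℕ → ℝ} (h : Lac c a) {R l N : ℕ} (hN : 2 * (R + 1) < N)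
    (hT : 1 ≤ TT c a l) (A : ℝ) :
    ∫ α in Set.Ioc A (A+1), CH a R l N α ≤ l * (∫ y, bump 1 R y) +
      N * l * ((2 * N + 2 * (R + 1)) / TT c a l) := by
  unfold CH
  rw [integral_finsetSum _ fun p _ => (cont_CH1 a hN p).integrableOn_Ioc]
  have h3 : (0:ℝ) ≤ ∫ y, bump 1 R y := integral_nonneg fun y => bump_nonneg 1 R y
  have hN0 : (0:ℝ) < N := by exact_mod_cast (by omega : 0 < N)
  have hTp := h.TT_pos l
  have hl := HH_lip (bump_supp 1 R) (bump_lip 1 R) hN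
  have hone : ∀ p ∈ CP l N, ∫ α in Set.Ioc A (A+1), HH (bump 1 R) N (fun _ => th a α p.2 - th a α p.1)
      ≤ (N:ℝ)⁻¹ * (∫ y, bump 1 R y) + (2 * N + 2 * (R + 1)) / TT c a l := by
    intro p hp
    have hp := mem_CP.1 hp
    have h1 := equi hl (B := (R:ℝ)+1) (fun t => bump_le 1 R _) hT (fun _ => a p.2 - a p.1)
      (fun _ => h.TT_le_sub hp.2.1 hp.2.2.1) (fun i j hij => absurd (Subsingleton.elim i j) hij) A
    rw [HH_int (bump_supp 1 R) hl.continuous hN] at h1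
    have e : ∀ α, (fun _ : Fin 1 => ((α * (a p.2 - a p.1) : ℝ) : UnitAddCircle))
        = fun _ => th a α p.2 - th a α p.1 := by
      intro α
      ext i
      rw [mul_sub]
      rfl
    simp only [e] at h1
    have h2 := (abs_le.1 h1).2
    simp only [Fintype.card_fin] at h2
    push_cast at h2
    rw [pow_one, one_mul] at h2
    have e3 : (2 * 1 * (N:ℝ) + 2 * (R + 1)) = 2 * N + 2 * (R + 1) := by ring
    rw [e3] at h2
    linarith
  calc _ ≤ ∑ p ∈ CP l N, ((N:ℝ)⁻¹ * (∫ y, bump 1 R y) + (2 * N + 2 * (R + 1)) / TT c a l) :=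
        Finset.sum_le_sum hone
    _ = (CP l N).card * ((N:ℝ)⁻¹ * (∫ y, bump 1 R y) + (2 * N + 2 * (R + 1)) / TT c a l) := by
        rw [Finset.sum_const, nsmul_eq_mul]
    _ ≤ (N * l : ℝ) * ((N:ℝ)⁻¹ * (∫ y, bump 1 R y) + (2 * N + 2 * (R + 1)) / TT c a l) := by
        gcongr
        exact_mod_cast card_CP l N
    _ = _ := by field_simp

lemma HH_bump_one {R N : ℕ} (s t : UnitAddCircle) (h : (N:ℝ) * dist s t ≤ R) :
    1 ≤ HH (bump 1 R) N (fun _ => t - s) := by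
  apply bump_one
  rw [pi_norm_le_iff_of_nonneg (by positivity)]
  intro i
  rw [norm_mul, Real.norm_eq_abs, Real.norm_eq_abs, abs_rep, abs_of_nonneg (Nat.cast_nonneg N)]
  rwa [dist_comm, dist_eq_norm] at h

lemma mem_XX {k N : ℕ} {x : Fin k → ℕ} :
    x ∈ XX k N ↔ (∀ i, 1 ≤ x i ∧ x i ≤ N) ∧ Function.Injective x := by
  simp [XX]

lemma nonsep_sum (hf : TF n f ρ Λ B) {a : ℕ → ℝ} {α : ℝ} {R N W l : ℕ} (hl : 1 ≤ l)
    (hR : 2 * n * ρ ≤ R) (hW : ∀ u, (win a α R N u).card ≤ W) :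
    |∑ x ∈ XX (n+1) N, FF f N (fun i => th a α (x i)) -
      ∑ x ∈ SS (Fin (n+1)) l N, FF f N (fun i => th a α (x i))|
      ≤ B * ((l + CH a R l N α) * W ^ (n+1)) := by
  classical
  have hsub : SS (Fin (n+1)) l N ⊆ XX (n+1) N := by
    intro x hx
    rw [mem_SS] at hx
    rw [mem_XX]
    refine ⟨hx.1, ?_⟩
    intro i j hij
    by_contra hne
    have := hx.2.2 i j hne
    omega
  rw [← Finset.sum_sdiff hsub, add_sub_cancel_right]
  set V := (CP l N).filter (fun p => (N:ℝ) * dist (th a α p.1) (th a α p.2) ≤ R) with hV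
  set U := Finset.Icc 1 l ∪ V.image Prod.fst with hU
  have hVc : (V.card : ℝ) ≤ CH a R l N α := by
    calc (V.card : ℝ) = ∑ p ∈ V, (1:ℝ) := by simp
      _ ≤ ∑ p ∈ V, HH (bump 1 R) N (fun _ => th a α p.2 - th a α p.1) :=
          Finset.sum_le_sum fun p hp => HH_bump_one _ _ (Finset.mem_filter.1 hp).2
      _ ≤ _ := Finset.sum_le_sum_of_subset_of_nonneg (Finset.filter_subset _ _)
          fun _ _ _ => bump_nonneg _ _ _
  have hUc : (U.card : ℝ) ≤ l + CH a R l N α := by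
    have h1 : U.card ≤ l + V.card := by
      refine (Finset.card_union_le _ _).trans ?_
      have := Finset.card_image_le (s := V) (f := Prod.fst)
      rw [Nat.card_Icc]; omega
    have h2 : (U.card : ℝ) ≤ l + V.card := by exact_mod_cast h1
    linarith
  have key := sum_U (g := fun x => FF f N (fun i => th a α (x i))) (b := B) B.2 hW U
    (XX (n+1) N \ SS (Fin (n+1)) l N) (by
      intro x hx
      rw [Finset.mem_sdiff, mem_XX, mem_SS] at hx
      obtain ⟨⟨h1, h2⟩, h3⟩ := hx
      refine ⟨h1, FF_bdd hf N _, ?_⟩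
      intro hne
      have hhit := hit_FF hf hR _ hne
      refine ⟨?_, hhit⟩
      have h4 : ¬ sep l x := fun hs => h3 ⟨h1, hs⟩
      by_cases h5 : ∃ i, x i ≤ l
      · obtain ⟨i, hi⟩ := h5
        exact ⟨i, Finset.mem_union_left _ (Finset.mem_Icc.2 ⟨(h1 i).1, hi⟩)⟩
      · push Not at h5
        have h6 : ∃ i j, x i < x j ∧ x j < x i + l := by
          by_contra hcon
          push Not at hcon
          apply h4
          refine ⟨h5, ?_⟩
          intro i j hij
          have hne' : x i ≠ x j := fun hh => hij (h2 hh)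
          rcases lt_or_gt_of_ne hne' with hlt | hlt
          · exact Or.inl (hcon i j hlt)
          · exact Or.inr (hcon j i hlt)
        obtain ⟨i, j, h7, h8⟩ := h6
        refine ⟨i, Finset.mem_union_right _ (Finset.mem_image.2 ⟨(x i, x j), ?_, rfl⟩)⟩
        rw [hV, Finset.mem_filter, mem_CP]
        exact ⟨⟨⟨h1 i, h1 j⟩, h5 i, h7, h8⟩, hhit i j⟩)
  refine key.trans ?_
  gcongr

lemma interp (hf : TF n f ρ Λ B) {a : ℕ → ℝ} {α : ℝ} {R N Q W : ℕ} (hN0 : 0 < N) (hNQ : N ≤ Q)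
    (hQN : Q ≤ 2 * N) (hR : 4 * n * ρ ≤ R) (hW : ∀ u, (win a α R Q u).card ≤ W) :
    |∑ x ∈ XX (n+1) Q, FF f Q (fun i => th a α (x i)) -
      ∑ x ∈ XX (n+1) N, FF f N (fun i => th a α (x i))|
      ≤ (B + 2 * Λ * ρ) * ((Q - N) * W ^ (n+1)) := by
  classical
  have hsub : XX (n+1) N ⊆ XX (n+1) Q := by
    intro x hx
    rw [mem_XX] at hx ⊢
    exact ⟨fun i => ⟨(hx.1 i).1, (hx.1 i).2.trans hNQ⟩, hx.2⟩
  rw [← Finset.sum_sdiff hsub, add_sub_assoc, ← Finset.sum_sub_distrib]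
  have hN' : (0:ℝ) < N := by exact_mod_cast hN0
  have hNQ' : (N:ℝ) ≤ Q := by exact_mod_cast hNQ
  have hQN' : (Q:ℝ) ≤ 2 * N := by exact_mod_cast hQN
  have k1 := sum_U (g := fun x => FF f Q (fun i => th a α (x i))) (b := B) B.2 hW (Finset.Ioc N Q)
    (XX (n+1) Q \ XX (n+1) N) (by
      intro x hx
      rw [Finset.mem_sdiff, mem_XX, mem_XX] at hx
      refine ⟨hx.1.1, FF_bdd hf Q _, fun hne => ⟨?_, ?_⟩⟩
      · by_contra hcon
        push Not at hcon
        refine hx.2 ⟨fun i => ⟨(hx.1.1 i).1, ?_⟩, hx.1.2⟩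
        have h1 := hcon i
        rw [Finset.mem_Ioc] at h1
        have h2 := (hx.1.1 i).2
        omega
      · exact hit_FF hf (le_trans (by nlinarith [Nat.zero_le (n * ρ)]) hR) _ hne)
  have hb0 : (0:ℝ) ≤ Λ * ρ * ((Q - N) / N) := by
    have : (0:ℝ) ≤ Q - N := by linarith
    positivity
  have k2 := sum_U (g := fun x => FF f Q (fun i => th a α (x i)) - FF f N (fun i => th a α (x i)))
    (b := Λ * ρ * ((Q - N) / N)) hb0 hW (Finset.Icc 1 Q) (XX (n+1) N) (by
      intro x hx
      rw [mem_XX] at hx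
      have hx1 : ∀ i, 1 ≤ x i ∧ x i ≤ Q := fun i => ⟨(hx.1 i).1, (hx.1 i).2.trans hNQ⟩
      refine ⟨hx1, ?_, ?_⟩
      · set t := (fun i => th a α (x i)) with ht
        by_cases hz : FF f Q t = 0 ∧ FF f N t = 0
        · rw [hz.1, hz.2, sub_zero, abs_zero]; exact hb0
        · set r : Fin n → ℝ := fun i => rep (dif t i) with hr
          have eN : FF f N t = f ((N:ℝ) • r) := rfl
          have eQ : FF f Q t = f ((Q:ℝ) • r) := rfl
          have hr1 : N * ‖r‖ ≤ ρ := by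
            by_contra hcon
            push Not at hcon
            apply hz
            rw [eN, eQ]
            constructor
            · apply hf.supp
              rw [norm_smul, Real.norm_natCast]
              exact hcon.trans_le (by gcongr)
            · apply hf.supp
              rwa [norm_smul, Real.norm_natCast]
          have h1 := hf.lip.dist_le_mul ((Q:ℝ) • r) ((N:ℝ) • r)
          rw [Real.dist_eq, dist_eq_norm, ← sub_smul, norm_smul, Real.norm_eq_abs,
            abs_of_nonneg (by linarith : (0:ℝ) ≤ (Q:ℝ) - N)] at h1
          rw [eN, eQ]
          refine h1.trans ?_
          have h2 : ‖r‖ ≤ ρ / N := by rw [le_div_iff₀ hN']; linarith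
          have h0 : (0:ℝ) ≤ Q - N := by linarith
          calc (Λ:ℝ) * ((Q - N) * ‖r‖) ≤ Λ * ((Q - N) * (ρ / N)) := by gcongr
            _ = _ := by ring
      · intro hne
        refine ⟨⟨0, Finset.mem_Icc.2 (hx1 0)⟩, ?_⟩
        intro i j
        by_cases hz : FF f Q (fun i => th a α (x i)) = 0
        · have hz2 : FF f N (fun i => th a α (x i)) ≠ 0 := by
            intro h2; apply hne; rw [hz, h2, sub_zero]
          have h3 := hit_FF hf le_rfl _ hz2 i j
          have h4 : (Q:ℝ) * dist (th a α (x i)) (th a α (x j)) ≤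
            2 * (N * dist (th a α (x i)) (th a α (x j))) := by
            rw [← mul_assoc]
            gcongr
          have h5 : (4 * n * ρ : ℝ) ≤ R := by exact_mod_cast hR
          push_cast at h3
          linarith
        · exact hit_FF hf (le_trans (by nlinarith [Nat.zero_le (n * ρ)]) hR) _ hz i j)
  refine (abs_add_le _ _).trans ((add_le_add k1 k2).trans ?_)
  rw [Nat.card_Ioc, Nat.card_Icc, Nat.cast_sub hNQ]
  have h0 : (0:ℝ) ≤ Q - N := by linarith
  have h6 : (Λ:ℝ) * ρ * ((Q - N) / N) * (((Q + 1 - 1 : ℕ) : ℝ) * W ^ (n+1)) ≤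
      2 * Λ * ρ * ((Q - N) * W ^ (n+1)) := by
    rw [Nat.add_sub_cancel]
    have : (Q:ℝ) / N ≤ 2 := by rw [div_le_iff₀ hN']; linarith
    calc (Λ:ℝ) * ρ * ((Q - N) / N) * ((Q : ℝ) * W ^ (n+1))
        = ((Q:ℝ) / N) * (Λ * ρ * ((Q - N) * W ^ (n+1))) := by ring
      _ ≤ 2 * (Λ * ρ * ((Q - N) * W ^ (n+1))) := by gcongr
      _ = _ := by ring
  linarith

end LacPC


namespace LacPC

variable {n : ℕ} {f : (Fin n → ℝ) → ℝ} {ρ : ℕ} {Λ B : NNReal}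

/-- integer `D`-th root -/
def lM (D M : ℕ) : ℕ := Nat.findGreatest (fun l => l ^ D ≤ M) M

lemma lM_pow {D : ℕ} (hD : 0 < D) (M : ℕ) : (lM D M) ^ D ≤ M :=
  Nat.findGreatest_spec (P := fun l => l ^ D ≤ M) (m := 0) (Nat.zero_le M)
    (by simp [Nat.pos_iff_ne_zero.1 hD])

lemma lM_ge {D K M : ℕ} (hD : 0 < D) (h : K ^ D ≤ M) : K ≤ lM D M :=
  Nat.le_findGreatest ((Nat.le_self_pow hD.ne' K).trans h) h

lemma lM_lt {D : ℕ} (hD : 0 < D) (M : ℕ) : M < (lM D M + 1) ^ D := by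
  by_contra hcon
  push Not at hcon
  have := lM_ge hD hcon
  omega

lemma lM_one {D M : ℕ} (hD : 0 < D) (hM : 1 ≤ M) : 1 ≤ lM D M := lM_ge hD (by simpa using hM)

lemma le_lM {D M : ℕ} (hD : 0 < D) (hM : 1 ≤ M) : M ≤ (2 * lM D M) ^ D :=
  (lM_lt hD M).le.trans (Nat.pow_le_pow_left (by have := lM_one hD hM; omega) _)

lemma tendsto_lM {D : ℕ} (hD : 0 < D) : Tendsto (lM D) atTop atTop := by
  rw [tendsto_atTop]
  intro K
  filter_upwards [eventually_ge_atTop (K ^ D)] with M hM using lM_ge hD hM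

lemma F2 {c : ℝ} {a : ℕ → ℝ} (h : Lac c a) {D : ℕ} (hD : 0 < D) (p : ℕ) :
    ∃ C : ℝ, 0 < C ∧ ∀ M : ℕ, 1 ≤ M → (M:ℝ) ^ p / TT c a (lM D M) ≤ C := by
  have h1 := tendsto_pow_const_div_const_pow_of_one_lt (D * p) h.one_lt
  obtain ⟨C, hC⟩ := h1.bddAbove_range
  have hk := h.kap_pos
  refine ⟨(2 ^ (D * p) * max C 1) / kap c a, by positivity, ?_⟩
  intro M hM
  have h2 : ((lM D M : ℕ) : ℝ) ^ (D * p) / c ^ (lM D M) ≤ max C 1 :=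
    (hC ⟨lM D M, rfl⟩).trans (le_max_left _ _)
  have h3 : (M:ℝ) ^ p ≤ (2 * (lM D M : ℝ)) ^ (D * p) := by
    rw [pow_mul]
    have : (M:ℝ) ≤ (2 * (lM D M : ℝ)) ^ D := by exact_mod_cast le_lM hD hM
    gcongr
  have hcp : 0 < c ^ (lM D M) := pow_pos (by linarith [h.one_lt]) _
  calc (M:ℝ) ^ p / TT c a (lM D M) ≤ (2 * (lM D M : ℝ)) ^ (D * p) / TT c a (lM D M) :=
        div_le_div_of_nonneg_right h3 (h.TT_pos _).le
    _ = (2 ^ (D * p) * (((lM D M : ℕ) : ℝ) ^ (D * p) / c ^ (lM D M))) / kap c a := by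
        unfold TT
        rw [mul_pow]
        field_simp
    _ ≤ _ := by gcongr

lemma ev_T {c : ℝ} {a : ℕ → ℝ} (h : Lac c a) {D : ℕ} (hD : 0 < D) :
    ∀ᶠ M in atTop, 1 ≤ TT c a (lM D M) := by
  obtain ⟨C, hC0, hC⟩ := F2 h hD 1
  filter_upwards [eventually_ge_atTop 1, eventually_ge_atTop ⌈C⌉₊] with M h1 h2
  have h3 := hC M h1
  have hT := h.TT_pos (lM D M)
  rw [div_le_iff₀ hT, pow_one] at h3
  have h4 : C ≤ M := Nat.ceil_le.1 h2
  nlinarith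

lemma ae_lemma {A C : ℝ} {q : ℕ → ℝ → ℝ}
    (hq : ∀ᶠ M in atTop, Continuous (q M) ∧ (∀ α, 0 ≤ q M α) ∧
      ∫ α in Set.Ioc A (A+1), q M α ≤ C / (M:ℝ) ^ 2) :
    ∀ᵐ α ∂(volume.restrict (Set.Ioc A (A+1))), Tendsto (fun M => q M α) atTop (nhds 0) := by
  obtain ⟨M0, hM0⟩ := eventually_atTop.1 hq
  set V := (volume : Measure ℝ).restrict (Set.Ioc A (A+1)) with hV
  have hm : ∀ M, AEMeasurable (fun α => ENNReal.ofReal (q (M + M0) α)) V := fun M =>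
    ((hM0 (M + M0) (by omega)).1.measurable.ennreal_ofReal).aemeasurable
  have hsum : ∑' M, ∫⁻ α, ENNReal.ofReal (q (M + M0) α) ∂V ≠ ⊤ := by
    have hle : ∀ M, ∫⁻ α, ENNReal.ofReal (q (M + M0) α) ∂V
        ≤ ENNReal.ofReal (C / ((M + M0 : ℕ) : ℝ) ^ 2) := by
      intro M
      obtain ⟨h1, h2, h3⟩ := hM0 (M + M0) (by omega)
      rw [← ofReal_integral_eq_lintegral_ofReal h1.integrableOn_Ioc (Eventually.of_forall h2)]
      exact ENNReal.ofReal_le_ofReal h3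
    refine ne_top_of_le_ne_top ?_ (ENNReal.tsum_le_tsum hle)
    have hs : Summable (fun M : ℕ => C / ((M + M0 : ℕ) : ℝ) ^ 2) := by
      have h1 : Summable (fun M : ℕ => C / (M : ℝ) ^ 2) := by
        simp_rw [div_eq_mul_inv]
        exact (Real.summable_nat_pow_inv.2 (by norm_num)).mul_left C
      exact (summable_nat_add_iff M0).2 h1
    exact hs.tsum_ofReal_ne_top
  rw [← lintegral_tsum hm] at hsum
  have hae := ae_lt_top' (AEMeasurable.ennreal_tsum hm) hsum
  filter_upwards [hae] with α hα
  have h1 := ENNReal.tendsto_atTop_zero_of_tsum_ne_top hα.ne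
  have h2 := (ENNReal.tendsto_toReal ENNReal.zero_ne_top).comp h1
  rw [← tendsto_add_atTop_iff_nat M0]
  refine h2.congr' ?_
  filter_upwards with M
  simp only [Function.comp]
  exact ENNReal.toReal_ofReal ((hM0 (M + M0) (by omega)).2.1 α)

end LacPC


namespace LacPC

variable {n : ℕ} {f : (Fin n → ℝ) → ℝ} {ρ : ℕ} {Λ B : NNReal}

/-- root exponent -/
def DD (n : ℕ) : ℕ := 4 * (n + 1) + 2

/-- number of points minus one in the large moment -/
def mm (n : ℕ) : ℕ := DD n * (8 * (n + 1)) - 1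

lemma DD_pos (n : ℕ) : 0 < DD n := by unfold DD; omega

lemma mm_succ (n : ℕ) : mm n + 1 = DD n * (8 * (n + 1)) := by
  unfold mm
  have : 0 < DD n * (8 * (n + 1)) := Nat.mul_pos (DD_pos n) (by omega)
  omega

/-- the majorant of the bad event -/
noncomputable def qG (a : ℕ → ℝ) (n R M : ℕ) (α : ℝ) : ℝ :=
  LH a (mm n) (2 * R) (lM (DD n) M) (M ^ 4) α * (4 ^ (mm n + 1) / (M:ℝ) ^ (8 * (n + 1)))

lemma qG_nonneg (a : ℕ → ℝ) (n R M : ℕ) (α : ℝ) : 0 ≤ qG a n R M α :=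
  mul_nonneg (LH_nonneg _ _ _ _ _ _) (by positivity)

lemma qG_good {a : ℕ → ℝ} {n R M : ℕ} {α : ℝ} (hM : 1 ≤ M) (hl : 2 * (mm n + 1) ≤ lM (DD n) M)
    (h : qG a n R M α < 1) (u : ℕ) :
    (win a α R (M ^ 4) u).card ≤ 2 * (lM (DD n) M) ^ 2 := by
  apply win_card (m := mm n) (lM_one (DD_pos n) hM)
  set l := lM (DD n) M with hl'
  have hM0 : (0:ℝ) < M := by exact_mod_cast hM
  have h1 : LH a (mm n) (2 * R) l (M ^ 4) α < (M:ℝ) ^ (8 * (n + 1)) / 4 ^ (mm n + 1) := by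
    unfold qG at h
    rw [lt_div_iff₀ (by positivity)]
    rw [← mul_div_assoc, div_lt_one (by positivity)] at h
    exact h
  refine h1.trans_le ?_
  have h2 : (M:ℝ) ^ (8 * (n+1)) ≤ (2 * (l:ℝ)) ^ (mm n + 1) := by
    rw [mm_succ, pow_mul (2 * (l:ℝ))]
    have : (M:ℝ) ≤ (2 * (l : ℝ)) ^ (DD n) := by exact_mod_cast le_lM (DD_pos n) hM
    gcongr
  have h3 : ((l + 1 - (mm n + 1)) ^ (mm n + 1) : ℕ) ≤ l.descFactorial (mm n + 1) :=
    Nat.pow_sub_le_descFactorial l (mm n + 1)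
  have h3' : (((l + 1 - (mm n + 1) : ℕ) : ℝ)) ^ (mm n + 1) ≤ (l.descFactorial (mm n + 1) : ℝ) := by
    exact_mod_cast h3
  refine le_trans ?_ h3'
  calc (M:ℝ) ^ (8 * (n + 1)) / 4 ^ (mm n + 1) ≤ (2 * (l:ℝ)) ^ (mm n + 1) / 4 ^ (mm n + 1) := by gcongr
    _ = ((l:ℝ) / 2) ^ (mm n + 1) := by
        rw [← div_pow]; congr 1; ring
    _ ≤ _ := by
        gcongr
        rw [div_le_iff₀ two_pos]
        have : l ≤ (l + 1 - (mm n + 1)) * 2 := by omega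
        exact_mod_cast this

lemma ev_pow (K : ℕ) : ∀ᶠ M : ℕ in atTop, K < M ^ 4 := by
  filter_upwards [eventually_gt_atTop K] with M hM
  exact hM.trans_le (Nat.le_self_pow (by norm_num) M)

lemma E_qG {c : ℝ} {a : ℕ → ℝ} (h : Lac c a) (n R : ℕ) (A : ℝ) :
    ∃ C : ℝ, ∀ᶠ M : ℕ in atTop, (M:ℝ) ^ (8 * (n+1)) * ∫ α in Set.Ioc A (A+1), qG a n R M α
      ≤ C * (M:ℝ) ^ 4 := by
  obtain ⟨C, hC0, hC⟩ := F2 h (DD_pos n) (4 * (mm n + 2))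
  refine ⟨4 ^ (mm n + 1) * ((∫ y, bump (mm n) (2 * R) y) +
    ((mm n + 1) * (4 * 1 + 2 * ((2 * R : ℕ) + 1))) * C), ?_⟩
  filter_upwards [ev_pow (2 * (2 * R + 1)), ev_T h (DD_pos n), eventually_ge_atTop 1] with M h1 h2 h3
  have hM1 : (1:ℝ) ≤ M := by exact_mod_cast h3
  have hM0 : (0:ℝ) < M := by linarith
  have hT := h.TT_pos (lM (DD n) M)
  have e1 := E_LH h (m := mm n) (R := 2 * R) h1 h2 A
  unfold qG
  rw [integral_mul_const]
  set X := ∫ α in Set.Ioc A (A+1), LH a (mm n) (2 * R) (lM (DD n) M) (M ^ 4) α with hX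
  have e2 : (M:ℝ) ^ (8 * (n+1)) * (X * (4 ^ (mm n + 1) / (M:ℝ) ^ (8 * (n + 1)))) = 4 ^ (mm n + 1) * X := by
    field_simp
  rw [e2, mul_assoc]
  gcongr
  refine e1.trans ?_
  have e3 := hC M h3
  push_cast
  set J := ∫ y, bump (mm n) (2 * R) y
  set T := TT c a (lM (DD n) M)
  have e4 : ((M:ℝ) ^ 4) ^ (mm n + 1) * ((((mm n : ℕ):ℝ) + 1) * (4 * 1 + 2 * (2 * (R:ℝ) + 1)) * ((M:ℝ) ^ 4 / T))
      = ((((mm n : ℕ):ℝ) + 1) * (4 * 1 + 2 * (2 * (R:ℝ) + 1))) * ((M:ℝ) ^ (4 * (mm n + 2)) / T) := by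
    have : (M:ℝ) ^ (4 * (mm n + 2)) = ((M:ℝ)^4) ^ (mm n + 1) * (M:ℝ)^4 := by
      rw [← pow_mul, ← pow_add]; congr 1
    rw [this]; ring
  rw [e4]
  set κ := ((((mm n : ℕ):ℝ) + 1) * (4 * 1 + 2 * (2 * (R:ℝ) + 1)))
  have hκ : 0 ≤ κ := by positivity
  have e5 : κ * ((M:ℝ) ^ (4 * (mm n + 2)) / T) ≤ κ * C := by gcongr
  have e6 : κ * C ≤ κ * C * (M:ℝ)^4 := le_mul_of_one_le_right (by positivity) (one_le_pow₀ hM1)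
  linarith

/-- a.e. eventually all windows are small -/
lemma ae_good {c : ℝ} {a : ℕ → ℝ} (h : Lac c a) (n R : ℕ) (A : ℝ) :
    ∀ᵐ α ∂(volume.restrict (Set.Ioc A (A+1))), ∀ᶠ M : ℕ in atTop,
      ∀ u, (win a α R (M ^ 4) u).card ≤ 2 * (lM (DD n) M) ^ 2 := by
  obtain ⟨C, hC⟩ := E_qG h n R A
  have h1 : ∀ᵐ α ∂(volume.restrict (Set.Ioc A (A+1))), Tendsto (fun M => qG a n R M α) atTop (nhds 0) := by
    apply ae_lemma (C := C)
    filter_upwards [hC, ev_pow (2 * (2 * R + 1)), eventually_ge_atTop 1] with M h1 h2 h3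
    refine ⟨(cont_LH a _ _ _ _ h2).mul continuous_const, qG_nonneg a n R M, ?_⟩
    have hM1 : (1:ℝ) ≤ M := by exact_mod_cast h3
    have hM0 : (0:ℝ) < M := by linarith
    rw [le_div_iff₀ (by positivity)]
    have e0 : 0 ≤ ∫ α in Set.Ioc A (A+1), qG a n R M α := integral_nonneg fun α => qG_nonneg a n R M α
    have e1 : (M:ℝ) ^ 6 ≤ (M:ℝ) ^ (8 * (n+1)) := pow_le_pow_right₀ hM1 (by omega)
    have e2 := (mul_le_mul_of_nonneg_right e1 e0).trans h1
    have e3 : ((∫ α in Set.Ioc A (A+1), qG a n R M α) * (M:ℝ)^2) * (M:ℝ)^4 ≤ C * (M:ℝ)^4 := by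
      refine le_trans (le_of_eq ?_) e2; ring
    exact le_of_mul_le_mul_right e3 (by positivity)
  filter_upwards [h1] with α hα
  filter_upwards [hα.eventually_lt_const one_pos, eventually_ge_atTop 1,
    (tendsto_lM (DD_pos n)).eventually_ge_atTop (2 * (mm n + 1))] with M h1 h2 h3
  exact qG_good h2 h3 h1

lemma lM_le_self (n M : ℕ) : ((lM (DD n) M : ℕ) : ℝ) ≤ M := by
  have h1 := lM_pow (DD_pos n) M
  have h2 := Nat.le_self_pow (DD_pos n).ne' (lM (DD n) M)
  exact_mod_cast h2.trans h1

lemma ae_CH {c : ℝ} {a : ℕ → ℝ} (h : Lac c a) (n R : ℕ) (A : ℝ) :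
    ∀ᵐ α ∂(volume.restrict (Set.Ioc A (A+1))),
      Tendsto (fun M => CH a R (lM (DD n) M) (M ^ 4) α * ((M:ℝ) ^ 3)⁻¹) atTop (nhds 0) := by
  obtain ⟨C, hC0, hC⟩ := F2 h (DD_pos n) 9
  apply ae_lemma (C := (∫ y, bump 1 R y) + (2 + 2 * (R + 1)) * C)
  filter_upwards [ev_pow (2 * (R + 1)), ev_T h (DD_pos n), eventually_ge_atTop 1] with M h1 h2 h3
  have hM1 : (1:ℝ) ≤ M := by exact_mod_cast h3
  have hM0 : (0:ℝ) < M := by linarith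
  refine ⟨(cont_CH a h1).mul continuous_const,
    fun α => mul_nonneg (CH_nonneg _ _ _ _ _) (by positivity), ?_⟩
  rw [integral_mul_const]
  have e1 := E_CH h h1 h2 A
  have hT := h.TT_pos (lM (DD n) M)
  have e3 := hC M h3
  have hl := lM_le_self n M
  set T := TT c a (lM (DD n) M)
  set J := ∫ y, bump 1 R y
  have hJ : (0:ℝ) ≤ J := integral_nonneg fun y => bump_nonneg 1 R y
  push_cast at e1
  have e4 : (lM (DD n) M : ℝ) * J ≤ M * J := by gcongr
  have e5 : (M:ℝ) ^ 4 * (lM (DD n) M : ℝ) * ((2 * (M:ℝ)^4 + 2 * (R + 1)) / T)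
      ≤ (2 + 2 * (R + 1)) * C := by
    have e6 : (2 * (M:ℝ)^4 + 2 * ((R:ℝ) + 1)) ≤ (2 + 2 * (R + 1)) * (M:ℝ)^4 := by
      have : (1:ℝ) ≤ (M:ℝ)^4 := one_le_pow₀ hM1
      have hR : (0:ℝ) ≤ R := R.cast_nonneg
      nlinarith
    calc _ ≤ (M:ℝ) ^ 4 * M * (((2 + 2 * (R + 1)) * (M:ℝ)^4) / T) := by gcongr
      _ = (2 + 2 * (R + 1)) * ((M:ℝ) ^ 9 / T) := by ring
      _ ≤ _ := by gcongr
  set K := (2 + 2 * ((R:ℝ) + 1)) * C with hK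
  have hK0 : 0 ≤ K := by positivity
  have e7 : K ≤ M * K := le_mul_of_one_le_left hK0 hM1
  calc _ ≤ (M * J + M * K) * ((M:ℝ) ^ 3)⁻¹ := by
        gcongr
        linarith
    _ = _ := by field_simp

end LacPC


namespace LacPC

variable {n : ℕ} {f : (Fin n → ℝ) → ℝ} {ρ : ℕ} {Λ B : NNReal}

lemma l_bound {n M : ℕ} (hM : 1 ≤ M) :
    (2 * (lM (DD n) M : ℝ) + 1) * (((2 * (lM (DD n) M) ^ 2 : ℕ) : ℝ) ^ (n+1) *
      ((2 * (lM (DD n) M) ^ 2 : ℕ) : ℝ) ^ (n+1)) ≤ 3 * 4 ^ (n+1) * M := by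
  have h1 : (lM (DD n) M : ℝ) ^ DD n ≤ M := by exact_mod_cast lM_pow (DD_pos n) M
  have h2 : (1:ℝ) ≤ lM (DD n) M := by exact_mod_cast lM_one (DD_pos n) hM
  set l : ℝ := (lM (DD n) M : ℝ) with hl
  push_cast
  rw [← hl, ← mul_pow]
  have e : (2 * l ^ 2 * (2 * l ^ 2)) ^ (n+1) = 4 ^ (n+1) * l ^ (4 * (n+1)) := by
    rw [pow_mul, ← mul_pow]; congr 1; ring
  rw [e]
  have h3 : l ^ (4 * (n+1)) * l ≤ M := by
    rw [← pow_succ]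
    exact (pow_le_pow_right₀ h2 (by unfold DD; omega)).trans h1
  calc (2 * l + 1) * (4 ^ (n+1) * l ^ (4 * (n+1))) ≤ (3 * l) * (4 ^ (n+1) * l ^ (4 * (n+1))) := by
        gcongr; linarith
    _ = 3 * 4 ^ (n+1) * (l ^ (4 * (n+1)) * l) := by ring
    _ ≤ _ := by gcongr

lemma s_bound {n M : ℕ} (hM : 1 ≤ M) :
    (1 - ((SS (Fin (n+1)) (lM (DD n) M) (M^4)).card : ℝ) / ((M^4 : ℕ) : ℝ) ^ (n+1)) ^ 2
      ≤ (3 * (((n:ℝ)+1) + (n+1) ^ 2)) ^ 2 / (M:ℝ) ^ 2 := by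
  have hM1 : (1:ℝ) ≤ M := by exact_mod_cast hM
  have hM0 : (0:ℝ) < M := by linarith
  have hl := lM_le_self n M
  have h1 : ((SS (Fin (n+1)) (lM (DD n) M) (M^4)).card : ℝ) ≤ ((M^4 : ℕ) : ℝ) ^ (n+1) := by
    exact_mod_cast card_SS_le (n+1) _ _
  have h2 : ((M^4 : ℕ) : ℝ) ^ (n+1) ≤ ((SS (Fin (n+1)) (lM (DD n) M) (M^4)).card : ℝ) +
      (((n:ℝ)+1) + (n+1) ^ 2) * ((2 * (lM (DD n) M : ℝ) + 1) * ((M^4 : ℕ) : ℝ) ^ n) := by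
    exact_mod_cast card_SS_ge n _ _
  set S := ((SS (Fin (n+1)) (lM (DD n) M) (M^4)).card : ℝ)
  set κ := (((n:ℝ)+1) + (n+1) ^ 2) with hκ
  have hκ0 : 0 ≤ κ := by positivity
  push_cast at h1 h2 ⊢
  have hP : (0:ℝ) < ((M:ℝ)^4) ^ (n+1) := by positivity
  rw [← div_pow]
  have h0 : 0 ≤ 1 - S / ((M:ℝ)^4) ^ (n+1) := by
    rw [sub_nonneg, div_le_one hP]; exact h1
  refine pow_le_pow_left₀ h0 ?_ 2
  rw [one_sub_div hP.ne', div_le_div_iff₀ hP hM0]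
  have h3 : ((M:ℝ)^4) ^ (n+1) - S ≤ κ * ((3 * M) * ((M:ℝ)^4) ^ n) := by
    have : κ * ((2 * (lM (DD n) M : ℝ) + 1) * ((M:ℝ)^4) ^ n) ≤ κ * ((3 * M) * ((M:ℝ)^4) ^ n) := by
      gcongr
      linarith
    linarith
  calc (((M:ℝ)^4) ^ (n+1) - S) * M ≤ (κ * ((3 * M) * ((M:ℝ)^4) ^ n)) * M := by gcongr
    _ = 3 * κ * (((M:ℝ)^4) ^ n * (M:ℝ)^2) := by ring
    _ ≤ 3 * κ * (((M:ℝ)^4) ^ n * (M:ℝ)^4) := by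
        gcongr
        norm_num
    _ = _ := by ring

lemma ae_YY {c : ℝ} {a : ℕ → ℝ} (h : Lac c a) (hf : TF n f ρ Λ B) (A : ℝ) :
    ∀ᵐ α ∂(volume.restrict (Set.Ioc A (A+1))),
      Tendsto (fun M : ℕ => YY f a (lM (DD n) M) (M ^ 4) α) atTop (nhds (∫ y, f y)) := by
  obtain ⟨C2, hC20, hC2⟩ := F2 h (DD_pos n) (8 * (n+1) + 4)
  obtain ⟨C1, hC10, hC1⟩ := F2 h (DD_pos n) (4 * (n+1) + 2)
  obtain ⟨C3, hC3⟩ := E_qG h n (4 * n * ρ) A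
  set I := ∫ y, f y with hI
  set c2 : ℝ := (2 * (n + 1)) * (8 * B * Λ + 2 * B ^ 2) with hc2
  set c1 : ℝ := (n + 1) * (4 * Λ + 2 * B) with hc1
  have key : ∀ᵐ α ∂(volume.restrict (Set.Ioc A (A+1))),
      Tendsto (fun M : ℕ => (YY f a (lM (DD n) M) (M ^ 4) α - I) ^ 2) atTop (nhds 0) := by
    apply ae_lemma (C := I ^ 2 * (3 * (((n:ℝ)+1) + (n+1) ^ 2)) ^ 2 +
      (c2 * C2 + B ^ 2 * (3 * 4 ^ (n+1) + |C3|)) + 2 * |I| * (c1 * C1))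
    filter_upwards [ev_pow (2 * ρ), ev_pow (2 * (2 * (4 * n * ρ) + 1)), ev_T h (DD_pos n),
      eventually_ge_atTop 1, hC3, (tendsto_lM (DD_pos n)).eventually_ge_atTop (2 * (mm n + 1))]
      with M h1 h2 h3 h4 h5 h6
    refine ⟨((cont_YY hf h1 a _).sub continuous_const).pow 2, fun α => sq_nonneg _, ?_⟩
    have hM1 : (1:ℝ) ≤ M := by exact_mod_cast h4
    have hM0 : (0:ℝ) < M := by linarith
    have hv := variance h hf (l := lM (DD n) M) (R := 4 * n * ρ) (W := 2 * (lM (DD n) M) ^ 2) h1 h3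
      (by nlinarith [Nat.zero_le (n * ρ)]) (qG a n (4 * n * ρ) M)
      ((cont_LH a _ _ _ _ h2).mul continuous_const)
      (qG_nonneg a n (4 * n * ρ) M) (fun α hα => qG_good h4 h6 hα) A
    refine hv.trans ?_
    have hT := h.TT_pos (lM (DD n) M)
    have hs := s_bound (n := n) h4
    have hlb := l_bound (n := n) h4
    have f1 := hC1 M h4
    have f2 := hC2 M h4
    clear hv
    rw [← hI, ← hc1, ← hc2]
    set T := TT c a (lM (DD n) M)
    set X := ∫ α in Set.Ioc A (A+1), qG a n (4 * n * ρ) M α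
    set Z := (2 * (lM (DD n) M : ℝ) + 1) * (((2 * (lM (DD n) M) ^ 2 : ℕ) : ℝ) ^ (n+1) *
      ((2 * (lM (DD n) M) ^ 2 : ℕ) : ℝ) ^ (n+1))
    rw [add_div, add_div]
    have hN : ((M ^ 4 : ℕ) : ℝ) = (M:ℝ)^4 := by push_cast; rfl
    have hc20 : 0 ≤ c2 := by positivity
    have hc10 : 0 ≤ c1 := by positivity
    have p1 : I ^ 2 * (1 - ((SS (Fin (n+1)) (lM (DD n) M) (M^4)).card : ℝ) / ((M^4 : ℕ) : ℝ) ^ (n+1)) ^ 2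
        ≤ I ^ 2 * (3 * (((n:ℝ)+1) + (n+1) ^ 2)) ^ 2 / (M:ℝ) ^ 2 := by
      rw [mul_div_assoc]; gcongr
    have p2 : (1 / ((M ^ 4 : ℕ) : ℝ) ^ 2) * (((M ^ 4 : ℕ) : ℝ) ^ (2 * (n+1)) * (c2 * (((M ^ 4 : ℕ) : ℝ) / T))
        + B ^ 2 * (((M ^ 4 : ℕ) : ℝ) * Z + ((M ^ 4 : ℕ) : ℝ) ^ (2 * (n+1)) * X))
        ≤ (c2 * C2 + B ^ 2 * (3 * 4 ^ (n+1) + |C3|)) / (M:ℝ) ^ 2 := by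
      rw [hN]
      have g1 : ((M:ℝ)^4) ^ (2 * (n+1)) = (M:ℝ) ^ (8 * (n+1)) := by
        rw [← pow_mul]; congr 1; ring
      rw [g1]
      have g2 : (M:ℝ) ^ (8 * (n+1)) * (c2 * ((M:ℝ)^4 / T)) ≤ c2 * C2 * (M:ℝ)^6 := by
        have : (M:ℝ) ^ (8 * (n+1)) * (c2 * ((M:ℝ)^4 / T)) = c2 * ((M:ℝ) ^ (8 * (n+1) + 4) / T) := by
          rw [pow_add]; ring
        rw [this]
        refine le_trans (by gcongr) (le_mul_of_one_le_right (by positivity) (one_le_pow₀ hM1))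
      have g3 : (M:ℝ)^4 * Z ≤ 3 * 4 ^ (n+1) * (M:ℝ)^6 := by
        calc (M:ℝ)^4 * Z ≤ (M:ℝ)^4 * (3 * 4 ^ (n+1) * M) := by gcongr
          _ = 3 * 4 ^ (n+1) * (M:ℝ)^5 := by ring
          _ ≤ _ := by
            gcongr
            norm_num
      have g4 : (M:ℝ) ^ (8 * (n+1)) * X ≤ |C3| * (M:ℝ)^6 := by
        refine h5.trans ?_
        refine le_trans (mul_le_mul_of_nonneg_right (le_abs_self C3) (by positivity)) ?_
        gcongr
        norm_num
      have g5 : (M:ℝ) ^ (8 * (n+1)) * (c2 * ((M:ℝ)^4 / T)) + B ^ 2 * ((M:ℝ)^4 * Z + (M:ℝ) ^ (8 * (n+1)) * X)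
          ≤ (c2 * C2 + B ^ 2 * (3 * 4 ^ (n+1) + |C3|)) * (M:ℝ)^6 := by
        have : (B:ℝ) ^ 2 * ((M:ℝ)^4 * Z + (M:ℝ) ^ (8 * (n+1)) * X) ≤
          B ^ 2 * (3 * 4 ^ (n+1) * (M:ℝ)^6 + |C3| * (M:ℝ)^6) := by gcongr
        linarith
      calc _ ≤ (1 / ((M:ℝ)^4)^2) * ((c2 * C2 + B ^ 2 * (3 * 4 ^ (n+1) + |C3|)) * (M:ℝ)^6) := by gcongr
        _ = _ := by field_simp
    have p3 : (2 * |I| / ((M ^ 4 : ℕ) : ℝ)) * (((M ^ 4 : ℕ) : ℝ) ^ (n+1) * (c1 * (((M ^ 4 : ℕ) : ℝ) / T)))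
        ≤ 2 * |I| * (c1 * C1) / (M:ℝ) ^ 2 := by
      rw [hN]
      have g1 : (2 * |I| / (M:ℝ)^4) * (((M:ℝ)^4) ^ (n+1) * (c1 * ((M:ℝ)^4 / T))) =
          2 * |I| * (c1 * ((M:ℝ) ^ (4 * (n+1) + 2) / T)) / (M:ℝ)^2 := by
        have : (M:ℝ)^(4*(n+1)+2) = ((M:ℝ)^4)^(n+1) * (M:ℝ)^2 := by rw [pow_add, pow_mul]
        rw [this]; field_simp
      rw [g1]
      gcongr
    exact add_le_add (add_le_add p1 p2) p3
  filter_upwards [key] with α hα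
  have h1 := hα.sqrt
  simp only [Real.sqrt_sq_eq_abs, Real.sqrt_zero] at h1
  rw [tendsto_iff_norm_sub_tendsto_zero]
  exact h1

end LacPC


namespace LacPC

variable {n : ℕ} {f : (Fin n → ℝ) → ℝ} {ρ : ℕ} {Λ B : NNReal}

/-- the normalised window bound -/
noncomputable def om (n M : ℕ) : ℝ := ((2 * (lM (DD n) M) ^ 2 : ℕ) : ℝ) ^ (n+1) / M

lemma om_nonneg (n M : ℕ) : 0 ≤ om n M := by unfold om; positivity

lemma tendsto_om (n : ℕ) : Tendsto (om n) atTop (nhds 0) := by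
  have h1 : Tendsto (fun M : ℕ => (2:ℝ) ^ (n+1) / (lM (DD n) M : ℝ)) atTop (nhds 0) :=
    tendsto_const_nhds.div_atTop (tendsto_natCast_atTop_atTop.comp (tendsto_lM (DD_pos n)))
  refine squeeze_zero' (Eventually.of_forall (om_nonneg n)) ?_ h1
  filter_upwards [eventually_ge_atTop 1] with M hM
  have h1 : (lM (DD n) M : ℝ) ^ DD n ≤ M := by exact_mod_cast lM_pow (DD_pos n) M
  have h2 : (1:ℝ) ≤ lM (DD n) M := by exact_mod_cast lM_one (DD_pos n) hM
  have hM1 : (1:ℝ) ≤ M := by exact_mod_cast hM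
  unfold om
  push_cast
  set l : ℝ := (lM (DD n) M : ℝ) with hl
  rw [div_le_div_iff₀ (by linarith) (by linarith)]
  have h3 : l ^ (2 * (n+1) + 1) ≤ M :=
    (pow_le_pow_right₀ h2 (by unfold DD; omega)).trans h1
  calc (2 * l ^ 2) ^ (n+1) * l = 2 ^ (n+1) * l ^ (2 * (n+1) + 1) := by
        rw [mul_pow, ← pow_mul, pow_succ]; ring
    _ ≤ _ := by gcongr

/-- the un-normalised correlation sum -/
noncomputable def AA (f : (Fin n → ℝ) → ℝ) (a : ℕ → ℝ) (α : ℝ) (N : ℕ) : ℝ :=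
  ∑ x ∈ XX (n+1) N, FF f N (fun i => th a α (x i))

lemma AA_fourth (hf : TF n f ρ Λ B) {a : ℕ → ℝ} {α I : ℝ}
    (h1 : ∀ᶠ M in atTop, ∀ u, (win a α (4 * n * ρ) (M^4) u).card ≤ 2*(lM (DD n) M)^2)
    (h2 : Tendsto (fun M : ℕ => CH a (4 * n * ρ) (lM (DD n) M) (M^4) α * ((M:ℝ)^3)⁻¹) atTop (nhds 0))
    (h3 : Tendsto (fun M : ℕ => YY f a (lM (DD n) M) (M ^ 4) α) atTop (nhds I)) :
    Tendsto (fun M : ℕ => AA f a α (M^4) / (M:ℝ)^4) atTop (nhds I) := by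
  have h4 : Tendsto (fun M : ℕ => (B:ℝ) * ((1 + CH a (4 * n * ρ) (lM (DD n) M) (M^4) α * ((M:ℝ)^3)⁻¹) * om n M))
      atTop (nhds 0) := by
    have := ((h2.const_add 1).mul (tendsto_om n)).const_mul (B:ℝ)
    simpa using this
  have h5 : Tendsto (fun M : ℕ => AA f a α (M^4) / (M:ℝ)^4 - YY f a (lM (DD n) M) (M ^ 4) α)
      atTop (nhds 0) := by
    refine squeeze_zero_norm' ?_ h4
    filter_upwards [h1, eventually_ge_atTop 1] with M hW hM
    have hM1 : (1:ℝ) ≤ M := by exact_mod_cast hM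
    have hM0 : (0:ℝ) < M := by linarith
    have hns := nonsep_sum hf (a := a) (α := α) (R := 4 * n * ρ) (lM_one (DD_pos n) hM)
      (by nlinarith [Nat.zero_le (n * ρ)]) hW
    have hl := lM_le_self n M
    have e : AA f a α (M^4) / (M:ℝ)^4 - YY f a (lM (DD n) M) (M ^ 4) α
        = (∑ x ∈ XX (n+1) (M^4), FF f (M^4) (fun i => th a α (x i)) -
      ∑ x ∈ SS (Fin (n+1)) (lM (DD n) M) (M^4), FF f (M^4) (fun i => th a α (x i))) / (M:ℝ)^4 := by
      unfold AA YY
      push_cast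
      ring
    rw [e, Real.norm_eq_abs, abs_div, abs_of_pos (a := (M:ℝ)^4) (by positivity), div_le_iff₀ (by positivity)]
    refine hns.trans ?_
    have hC := CH_nonneg a (4 * n * ρ) (lM (DD n) M) (M^4) α
    have e2 : (B:ℝ) * ((1 + CH a (4 * n * ρ) (lM (DD n) M) (M^4) α * ((M:ℝ)^3)⁻¹) * om n M) * (M:ℝ)^4
        = B * (((M:ℝ)^3 + CH a (4 * n * ρ) (lM (DD n) M) (M^4) α) * ((2 * (lM (DD n) M) ^ 2 : ℕ) : ℝ) ^ (n+1)) := by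
      unfold om
      field_simp
    rw [e2]
    have : (M:ℝ) ≤ (M:ℝ)^3 := le_self_pow₀ hM1 (by norm_num)
    gcongr
    linarith
  have := h5.add h3
  simpa using this

lemma AA_all (hf : TF n f ρ Λ B) {a : ℕ → ℝ} {α I : ℝ}
    (h1 : ∀ᶠ M in atTop, ∀ u, (win a α (4 * n * ρ) (M^4) u).card ≤ 2*(lM (DD n) M)^2)
    (h3 : Tendsto (fun M : ℕ => AA f a α (M^4) / (M:ℝ)^4) atTop (nhds I)) :
    Tendsto (fun N : ℕ => AA f a α N / (N:ℝ)) atTop (nhds I) := by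
  have hm : Tendsto (fun N : ℕ => lM 4 N + 1) atTop atTop :=
    (tendsto_add_atTop_nat 1).comp (tendsto_lM (D := 4) (by norm_num))
  have bd : ∀ᶠ N : ℕ in atTop, 0 < N ∧ 8 ≤ lM 4 N + 1 ∧ N ≤ (lM 4 N + 1)^4 ∧ (lM 4 N + 1)^4 ≤ 2 * N ∧
      (((lM 4 N + 1 : ℕ):ℝ)^4 - N ≤ 4 * ((lM 4 N + 1 : ℕ):ℝ)^3) := by
    filter_upwards [eventually_gt_atTop 0, hm.eventually_ge_atTop 8] with N hN h8
    have q1 := lM_pow (D := 4) (by norm_num) N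
    have q2 := lM_lt (D := 4) (by norm_num) N
    generalize lM 4 N = l at *
    have q1' : (l:ℝ)^4 ≤ N := by exact_mod_cast q1
    have hl : (7:ℝ) ≤ l := by exact_mod_cast (by omega : 7 ≤ l)
    have q3 : ((l + 1 : ℕ):ℝ)^4 - N ≤ 4 * ((l + 1 : ℕ):ℝ)^3 := by
      push_cast
      nlinarith [mul_nonneg (by linarith : (0:ℝ) ≤ l) (by linarith : (0:ℝ) ≤ l)]
    refine ⟨hN, h8, q2.le, ?_, q3⟩
    have : ((l + 1 : ℕ):ℝ)^4 ≤ 2 * N := by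
      have h8' : (8:ℝ) ≤ ((l+1:ℕ):ℝ) := by exact_mod_cast h8
      have : 8 * ((l + 1 : ℕ):ℝ)^3 ≤ ((l + 1 : ℕ):ℝ)^4 := by
        rw [pow_succ ((l + 1 : ℕ):ℝ) 3, mul_comm]
        gcongr
      linarith
    exact_mod_cast this
  -- first comparison
  have c1 : Tendsto (fun N : ℕ => AA f a α ((lM 4 N + 1)^4) / ((lM 4 N + 1 : ℕ):ℝ)^4) atTop (nhds I) :=
    h3.comp hm
  have c2 : Tendsto (fun N : ℕ => AA f a α ((lM 4 N + 1)^4) / ((lM 4 N + 1 : ℕ):ℝ)^4 -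
      AA f a α N / ((lM 4 N + 1 : ℕ):ℝ)^4) atTop (nhds 0) := by
    have h4 : Tendsto (fun N : ℕ => (((B:ℝ) + 2 * Λ * ρ) * 4) * om n (lM 4 N + 1)) atTop (nhds 0) := by
      have := ((tendsto_om n).comp hm).const_mul (((B:ℝ) + 2 * Λ * ρ) * 4)
      simpa using this
    refine squeeze_zero_norm' ?_ h4
    filter_upwards [bd, hm.eventually h1] with N ⟨b1, b0, b2, b3, b4⟩ hW
    have hi := interp hf b1 b2 b3 le_rfl hW
    have hp : (0:ℝ) < ((lM 4 N + 1 : ℕ):ℝ) := by positivity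
    rw [← sub_div, Real.norm_eq_abs, abs_div, abs_of_pos (a := ((lM 4 N + 1 : ℕ):ℝ)^4) (by positivity),
      div_le_iff₀ (by positivity)]
    refine hi.trans ?_
    have e : (((B:ℝ) + 2 * Λ * ρ) * 4) * om n (lM 4 N + 1) * ((lM 4 N + 1 : ℕ):ℝ)^4
       = ((B:ℝ) + 2 * Λ * ρ) * ((4 * ((lM 4 N + 1 : ℕ):ℝ)^3) * ((2 * (lM (DD n) (lM 4 N + 1)) ^ 2 : ℕ) : ℝ) ^ (n+1)) := by
      unfold om
      field_simp
    rw [e]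
    rw [Nat.cast_pow]
    gcongr
  have c3 : Tendsto (fun N : ℕ => AA f a α N / ((lM 4 N + 1 : ℕ):ℝ)^4) atTop (nhds I) := by
    have := c1.sub c2
    simpa using this
  have c4 : Tendsto (fun N : ℕ => ((lM 4 N + 1 : ℕ):ℝ)^4 / N - 1) atTop (nhds 0) := by
    have h4 : Tendsto (fun N : ℕ => (8:ℝ) / ((lM 4 N + 1 : ℕ):ℝ)) atTop (nhds 0) :=
      tendsto_const_nhds.div_atTop (tendsto_natCast_atTop_atTop.comp hm)
    refine squeeze_zero_norm' ?_ h4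
    filter_upwards [bd] with N ⟨b1, b0, b2, b3, b4⟩
    have b2' : (N:ℝ) ≤ ((lM 4 N + 1 : ℕ):ℝ)^4 := by exact_mod_cast b2
    have b3' : ((lM 4 N + 1 : ℕ):ℝ)^4 ≤ 2 * N := by exact_mod_cast b3
    have b1' : (0:ℝ) < N := by exact_mod_cast b1
    have hp : (0:ℝ) < ((lM 4 N + 1 : ℕ):ℝ) := by positivity
    rw [div_sub_one b1'.ne', Real.norm_eq_abs, abs_of_nonneg (by apply div_nonneg <;> linarith),
      div_le_div_iff₀ b1' hp]
    calc _ ≤ 4 * ((lM 4 N + 1 : ℕ):ℝ)^3 * ((lM 4 N + 1 : ℕ):ℝ) := by gcongr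
      _ = 4 * ((lM 4 N + 1 : ℕ):ℝ)^4 := by ring
      _ ≤ _ := by linarith
  have c5 : Tendsto (fun N : ℕ => ((lM 4 N + 1 : ℕ):ℝ)^4 / N) atTop (nhds 1) := by
    have := c4.add_const 1
    simpa using this
  have c6 := c3.mul c5
  rw [mul_one] at c6
  refine c6.congr fun N => ?_
  have hp : (0:ℝ) < ((lM 4 N + 1 : ℕ):ℝ) := by positivity
  field_simp

lemma ae_AA {c : ℝ} {a : ℕ → ℝ} (h : Lac c a) (hf : TF n f ρ Λ B) :
    ∀ᵐ α : ℝ, Tendsto (fun N : ℕ => AA f a α N / (N:ℝ)) atTop (nhds (∫ y, f y)) := by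
  have hA : ∀ A : ℤ, ∀ᵐ α ∂(volume.restrict (Set.Ioc (A:ℝ) (A+1))),
      Tendsto (fun N : ℕ => AA f a α N / (N:ℝ)) atTop (nhds (∫ y, f y)) := by
    intro A
    filter_upwards [ae_good h n (4 * n * ρ) A, ae_CH h n (4 * n * ρ) A, ae_YY h hf A] with α h1 h2 h3
    exact AA_all hf h1 (AA_fourth hf h1 h2 h3)
  have := (ae_restrict_iUnion_iff (μ := volume) (fun A : ℤ => Set.Ioc (A:ℝ) (A+1)) _).2 hA
  rwa [iUnion_Ioc_intCast, Measure.restrict_univ] at this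

lemma ae_corr {c : ℝ} {a : ℕ → ℝ} (h : Lac c a) (hf : TF n f ρ Λ B) :
    ∀ᵐ α : ℝ, Tendsto (fun N : ℕ => corrSum (n+1) N (fun j => α * a j) f) atTop (nhds (∫ y, f y)) := by
  filter_upwards [ae_AA h hf] with α hα
  refine hα.congr' ?_
  filter_upwards [eventually_gt_atTop (2 * ρ)] with N hN
  rw [corr_eq hf.supp hN]
  unfold AA
  ring

end LacPC


namespace LacPC

variable {n : ℕ} {f : (Fin n → ℝ) → ℝ} {ρ : ℕ} {Λ B : NNReal}

lemma TF.integrable (hf : TF n f ρ Λ B) : Integrable f := by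
  refine hf.lip.continuous.integrable_of_hasCompactSupport ?_
  refine HasCompactSupport.intro (isCompact_closedBall (0 : Fin n → ℝ) (ρ:ℝ)) fun y hy => hf.supp y ?_
  simpa using hy

lemma AA_sub_le {g : (Fin n → ℝ) → ℝ} {η : ℝ} (h : ∀ y, |f y - g y| ≤ η * bump n ρ y)
    (a : ℕ → ℝ) (α : ℝ) (N : ℕ) : |AA f a α N - AA g a α N| ≤ η * AA (bump n ρ) a α N := by
  unfold AA
  rw [← Finset.sum_sub_distrib, Finset.mul_sum]
  exact (Finset.abs_sum_le_sum_abs _ _).trans (Finset.sum_le_sum fun x _ => h _)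

/-- the admissible test functions supported in the ball of radius `ρ` -/
def Adm (n ρ : ℕ) : Set C(Fin n → ℝ, ℝ) := {g | ∃ Λ B, TF n g ρ Λ B}

lemma ae_Adm {c : ℝ} {a : ℕ → ℝ} (h : Lac c a) (n ρ : ℕ) :
    ∀ᵐ α : ℝ, ∀ g ∈ Adm n ρ,
      Tendsto (fun N : ℕ => AA g a α N / (N:ℝ)) atTop (nhds (∫ y, g y)) := by
  obtain ⟨s, hsub, hs, hd⟩ := (TopologicalSpace.IsSeparable.of_separableSpace (Adm n ρ)).exists_countable_dense_subset
  have h1 : ∀ᵐ α : ℝ, ∀ g ∈ s, Tendsto (fun N : ℕ => AA g a α N / (N:ℝ)) atTop (nhds (∫ y, g y)) := by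
    rw [ae_ball_iff hs]
    intro g hg
    obtain ⟨Λ, B, hT⟩ := hsub hg
    exact ae_AA h hT
  filter_upwards [h1, ae_AA h (bump_TF n ρ)] with α hα hb f hf
  set J := ∫ y, bump n ρ y with hJ
  have hJ0 : 0 ≤ J := integral_nonneg (bump_nonneg n ρ)
  obtain ⟨Λ, B, hT⟩ := hf
  rw [Metric.tendsto_nhds]
  intro ε hε
  set η := ε / (2 * (2 * J + 2)) with hη
  have hη0 : 0 < η := by positivity
  have hfc : f ∈ closure s := hd ⟨Λ, B, hT⟩
  obtain ⟨u, hu, hul⟩ := mem_closure_iff_seq_limit.1 hfc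
  have hun := ContinuousMap.tendsto_iff_forall_isCompact_tendstoUniformlyOn.1 hul _
    (isCompact_closedBall (0 : Fin n → ℝ) (ρ:ℝ))
  obtain ⟨j, hj⟩ := (Metric.tendstoUniformlyOn_iff.1 hun η hη0).exists
  set g := u j
  obtain ⟨Λ', B', hT'⟩ := hsub (hu j)
  have hfg : ∀ y, |f y - g y| ≤ η * bump n ρ y := by
    intro y
    by_cases hy : ‖y‖ ≤ ρ
    · have h2 := hj y (by simpa using hy)
      rw [Real.dist_eq] at h2
      nlinarith [bump_one n ρ y hy]
    · push Not at hy
      rw [hT.supp y hy, hT'.supp y hy, sub_zero, abs_zero]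
      exact mul_nonneg hη0.le (bump_nonneg _ _ _)
  have hI : |(∫ y, f y) - ∫ y, g y| ≤ η * J := by
    rw [← integral_sub hT.integrable hT'.integrable, hJ, ← integral_const_mul]
    refine (abs_integral_le_integral_abs).trans ?_
    exact integral_mono (hT.integrable.sub hT'.integrable).abs ((bump_TF n ρ).integrable.const_mul _) hfg
  filter_upwards [Metric.tendsto_nhds.1 (hα g (hu j)) (ε / 2) (by positivity),
    Metric.tendsto_nhds.1 hb 1 one_pos] with N hN1 hN2
  rw [Real.dist_eq] at hN1 hN2 ⊢
  have h3 : |AA f a α N / N - AA g a α N / N| ≤ η * (AA (bump n ρ) a α N / N) := by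
    rw [← sub_div, abs_div, Nat.abs_cast, ← mul_div_assoc]
    gcongr
    exact AA_sub_le hfg a α N
  have h4 : AA (bump n ρ) a α N / N ≤ J + 1 := by
    have := (abs_lt.1 hN2).2
    linarith
  have h5 : η * (AA (bump n ρ) a α N / N) ≤ η * (J + 1) := by gcongr
  have h6 : η * (2 * J + 2) = ε / 2 := by rw [hη]; field_simp
  have e : AA f a α N / N - ∫ y, f y = (AA f a α N / N - AA g a α N / N) +
    (AA g a α N / N - ∫ y, g y) - ((∫ y, f y) - ∫ y, g y) := by ring
  rw [e]
  have h7 := abs_sub ((AA f a α N / N - AA g a α N / N) +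
    (AA g a α N / N - ∫ y, g y)) ((∫ y, f y) - ∫ y, g y)
  have h8 := abs_add_le (AA f a α N / N - AA g a α N / N) (AA g a α N / N - ∫ y, g y)
  nlinarith

lemma smooth_TF {f : (Fin n → ℝ) → ℝ} (hf : ContDiff ℝ (⊤ : ℕ∞) f) (hc : HasCompactSupport f) :
    ∃ ρ : ℕ, ∃ Λ B, TF n f ρ Λ B := by
  obtain ⟨Λ, hΛ⟩ := ContDiff.lipschitzWith_of_hasCompactSupport hc hf (by simp)
  obtain ⟨C, hC⟩ := hc.exists_bound_of_continuous hf.continuous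
  obtain ⟨r, hr⟩ := hc.isBounded.subset_closedBall (0 : Fin n → ℝ)
  obtain ⟨ρ, hρ⟩ := exists_nat_ge r
  refine ⟨ρ, Λ, C.toNNReal, ⟨fun y hy => ?_, hΛ, fun y => ?_⟩⟩
  · by_contra hne
    have := hr (subset_tsupport f hne)
    rw [mem_closedBall_zero_iff] at this
    linarith
  · exact (hC y).trans (Real.le_coe_toNNReal C)

lemma main {c : ℝ} {a : ℕ → ℝ} (h : Lac c a) :
    ∀ᵐ α : ℝ, ∀ n : ℕ, ∀ f : (Fin n → ℝ) → ℝ, ContDiff ℝ (⊤ : ℕ∞) f → HasCompactSupport f →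
      Tendsto (fun N : ℕ => corrSum (n+1) N (fun j => α * a j) f) atTop (nhds (∫ y, f y)) := by
  have := ae_all_iff.2 fun n => ae_all_iff.2 fun ρ => ae_Adm h n ρ
  filter_upwards [this] with α hα n f hf hc
  obtain ⟨ρ, Λ, B, hT⟩ := smooth_TF hf hc
  refine (hα n ρ ⟨f, hf.continuous⟩ ⟨Λ, B, hT⟩).congr' ?_
  filter_upwards [eventually_gt_atTop (2 * ρ)] with N hN
  rw [corr_eq hT.supp hN]
  unfold AA
  simp only [ContinuousMap.coe_mk]
  ring

end LacPC

theorem stmt11 (c : ℝ) (hc : 1 < c) (a : ℕ → ℝ) (ha1 : 0 < a 1)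
    (hpos : ∀ n ≥ 1, 0 < a n) (hlac : ∀ n ≥ 1, c * a n ≤ a (n + 1)) :
    ∀ᵐ α : ℝ, ∀ k : ℕ, 2 ≤ k →
      ∀ f : (Fin (k - 1) → ℝ) → ℝ, ContDiff ℝ (⊤ : ℕ∞) f → HasCompactSupport f →
        Tendsto (fun N => corrSum k N (fun n => α * a n) f) atTop
          (nhds (∫ x : Fin (k - 1) → ℝ, f x)) := by
  filter_upwards [LacPC.main (c := c) (a := a) ⟨hc, hpos, hlac⟩] with α hα k hk f hf hcs
  obtain ⟨n, rfl⟩ : ∃ n, k = n + 1 := ⟨k - 1, by omega⟩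
  exact hα n f hf hcs
end

section
/- Let (a_n) be a sequence of real numbers that is uniformly discrete: there exists δ > 0 with |a_n − a_m| ≥ δ for all n ≠ m. Then for almost all α ∈ ℝ, the sequence (α a_n) is uniformly distributed modulo one. -/
open Filter

lemma aux_sep_bound (b : ℕ → ℝ) (δ : ℝ) (hδ : 0 < δ)
    (hsep : ∀ n m : ℕ, 1 ≤ n → 1 ≤ m → n ≠ m → δ ≤ |b n - b m|) :
    ∃ C : ℝ, 0 ≤ C ∧ ∀ N n : ℕ,
      ∑ m ∈ Finset.Icc 1 N, Real.exp (-(b n - b m) ^ 2 / 2) ≤ C := by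
  have hs : Summable (fun j : ℤ => 1 / (1 + (j : ℝ) ^ 2)) := by
    refine Summable.of_norm_bounded_eventually
      (Real.summable_one_div_int_pow.mpr (by norm_num : 1 < 2)) ?_
    have : ∀ᶠ j : ℤ in cofinite, j ≠ 0 := by
      simpa using (Set.finite_singleton (0:ℤ)).compl_mem_cofinite
    filter_upwards [this] with j hj
    have : (0:ℝ) < (j:ℝ)^2 := by positivity
    rw [Real.norm_of_nonneg (by positivity)]
    exact one_div_le_one_div_of_le this (by linarith)
  set K : ℝ := 3 * (1 + 2 / δ ^ 2) with hK
  have hKpos : 0 < K := by positivity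
  have key : ∀ x : ℝ, Real.exp (-x ^ 2 / 2) ≤ K * (1 / (1 + ((⌊x / δ⌋ : ℤ) : ℝ) ^ 2)) := by
    intro x
    set j : ℝ := ((⌊x / δ⌋ : ℤ) : ℝ)
    set y := x / δ with hy
    have hxy : x = y * δ := by rw [hy]; field_simp
    have h1 : j ≤ y := Int.floor_le _
    have h2 : y < j + 1 := Int.lt_floor_add_one _
    have h3 : 1 + j ^ 2 ≤ 3 * (1 + y ^ 2) := by nlinarith [sq_nonneg (y + (y - j))]
    have h4 : 1 + y ^ 2 ≤ (1 + 2 / δ ^ 2) * (1 + x ^ 2 / 2) := by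
      have : y ^ 2 = 2 / δ ^ 2 * (x ^ 2 / 2) := by rw [hy]; field_simp
      have h5 : 0 ≤ 2 / δ ^ 2 := by positivity
      nlinarith [sq_nonneg x]
    have h6 : 1 + x ^ 2 / 2 ≤ Real.exp (x ^ 2 / 2) := by
      linarith [Real.add_one_le_exp (x ^ 2 / 2)]
    have h7 : 1 + j ^ 2 ≤ K * Real.exp (x ^ 2 / 2) := by
      have h8 : (1 + 2 / δ ^ 2) * (1 + x ^ 2 / 2) ≤ (1 + 2 / δ ^ 2) * Real.exp (x ^ 2 / 2) := by
        gcongr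
      rw [hK]; nlinarith
    rw [neg_div, Real.exp_neg, mul_one_div, inv_eq_one_div, div_le_div_iff₀ (Real.exp_pos _) (by positivity)]
    linarith
  refine ⟨K * ∑' j : ℤ, 1 / (1 + (j : ℝ) ^ 2), by positivity, fun N n => ?_⟩
  have hinj : Set.InjOn (fun m : ℕ => ⌊(b n - b m) / δ⌋) (Finset.Icc 1 N : Finset ℕ) := by
    intro m hm m' hm' h
    by_contra hne
    simp only [Finset.coe_Icc, Set.mem_Icc] at hm hm'
    have h1 := hsep m m' hm.1 hm'.1 hne
    have h2 := Int.abs_sub_lt_one_of_floor_eq_floor h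
    rw [← sub_div, abs_div, abs_of_pos hδ, div_lt_one hδ] at h2
    rw [abs_sub_comm] at h1
    have : b n - b m - (b n - b m') = b m' - b m := by ring
    rw [this] at h2
    linarith
  calc ∑ m ∈ Finset.Icc 1 N, Real.exp (-(b n - b m) ^ 2 / 2)
      ≤ ∑ m ∈ Finset.Icc 1 N, K * (1 / (1 + ((⌊(b n - b m) / δ⌋ : ℤ) : ℝ) ^ 2)) :=
        Finset.sum_le_sum fun m _ => key _
    _ = K * ∑ j ∈ (Finset.Icc 1 N).image (fun m : ℕ => ⌊(b n - b m) / δ⌋),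
          (1 / (1 + (j : ℝ) ^ 2)) := by
        rw [Finset.sum_image hinj, Finset.mul_sum]
    _ ≤ _ := by
        gcongr
        exact hs.sum_le_tsum _ (fun j _ => by positivity)

open MeasureTheory ProbabilityTheory in
lemma aux_moment (b : ℕ → ℝ) (N : ℕ) :
    ∫ x, ‖∑ n ∈ Finset.Icc 1 N, Complex.exp (x * b n * Complex.I)‖ ^ 2 ∂(gaussianReal 0 1)
      = ∑ n ∈ Finset.Icc 1 N, ∑ m ∈ Finset.Icc 1 N, Real.exp (-(b n - b m) ^ 2 / 2) := by
  have hint : ∀ t : ℝ, Integrable (fun x : ℝ => Complex.exp (t * x * Complex.I))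
      (gaussianReal 0 1) := by
    intro t
    refine Integrable.of_bound (C := 1) (by fun_prop) (ae_of_all _ fun x => ?_)
    rw [← Complex.ofReal_mul, Complex.norm_exp_ofReal_mul_I]
  have h1 : ∀ x : ℝ, ((‖∑ n ∈ Finset.Icc 1 N, Complex.exp (x * b n * Complex.I)‖ ^ 2 : ℝ) : ℂ)
      = ∑ n ∈ Finset.Icc 1 N, ∑ m ∈ Finset.Icc 1 N,
        Complex.exp ((b n - b m : ℝ) * x * Complex.I) := by
    intro x
    rw [Complex.ofReal_pow, ← Complex.mul_conj', map_sum, Finset.sum_mul_sum]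
    refine Finset.sum_congr rfl fun n _ => Finset.sum_congr rfl fun m _ => ?_
    rw [← Complex.exp_conj, ← Complex.exp_add]
    congr 1
    simp
    ring
  have h2 : ∀ t : ℝ, ∫ x : ℝ, Complex.exp (t * x * Complex.I) ∂(gaussianReal 0 1)
      = (Real.exp (-t ^ 2 / 2) : ℝ) := by
    intro t
    rw [← charFun_apply_real, charFun_gaussianReal]
    push_cast
    congr 1
    simp
    ring
  rw [← Complex.ofReal_inj, ← integral_complex_ofReal]
  simp_rw [h1]
  rw [integral_finsetSum _ (fun n _ => integrable_finsetSum _ fun m _ => hint _)]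
  rw [Complex.ofReal_sum]
  refine Finset.sum_congr rfl fun n _ => ?_
  rw [Complex.ofReal_sum, integral_finsetSum _ (fun m _ => hint _)]
  refine Finset.sum_congr rfl fun m _ => ?_
  rw [h2]

lemma aux_fill (z : ℕ → ℂ) (hz : ∀ n, ‖z n‖ ≤ 1)
    (h : Tendsto (fun j : ℕ => ‖∑ n ∈ Finset.Icc 1 (j ^ 2), z n‖ / (j : ℝ) ^ 2) atTop (nhds 0)) :
    Tendsto (fun N : ℕ => (∑ n ∈ Finset.Icc 1 N, z n) / (N : ℂ)) atTop (nhds 0) := by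
  have hsq : Tendsto Nat.sqrt atTop atTop := by
    refine tendsto_atTop.mpr fun k => ?_
    filter_upwards [eventually_ge_atTop (k * k)] with N hN
    exact Nat.le_sqrt.mpr hN
  have h2 : Tendsto (fun j : ℕ => ‖∑ n ∈ Finset.Icc 1 (j ^ 2), z n‖ / (j : ℝ) ^ 2 + 2 / (j : ℝ))
      atTop (nhds 0) := by
    simpa using h.add (tendsto_const_div_atTop_nhds_zero_nat (2 : ℝ))
  refine squeeze_zero_norm' ?_ (h2.comp hsq)
  filter_upwards [eventually_ge_atTop 1] with N hN
  simp only [Function.comp, norm_div, Complex.norm_natCast]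
  set j := Nat.sqrt N with hj
  have hj1 : 1 ≤ j := Nat.le_sqrt.mpr (by simpa using hN)
  have hjN : j ^ 2 ≤ N := Nat.sqrt_le' N
  have hNj : N ≤ j ^ 2 + 2 * j := by
    have := Nat.sqrt_le_add N
    rw [← hj] at this
    rw [pow_two]; omega
  have hsplit : ∑ n ∈ Finset.Icc 1 N, z n
      = ∑ n ∈ Finset.Icc 1 (j ^ 2), z n + ∑ n ∈ Finset.Ioc (j ^ 2) N, z n := by
    rw [← Finset.sum_union]
    · congr 1
      ext n; simp; omega
    · rw [Finset.disjoint_left]; intro n; simp; omega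
  have hb : ‖∑ n ∈ Finset.Ioc (j ^ 2) N, z n‖ ≤ 2 * j := by
    refine (norm_sum_le_of_le _ (fun n _ => hz n)).trans ?_
    simp only [Finset.sum_const, Nat.card_Ioc, nsmul_eq_mul, mul_one]
    exact_mod_cast (by omega : N - j ^ 2 ≤ 2 * j)
  have hj0 : (0:ℝ) < j := by exact_mod_cast hj1
  have hjN' : (j : ℝ) ^ 2 ≤ N := by exact_mod_cast hjN
  rw [hsplit]
  calc _ ≤ (‖∑ n ∈ Finset.Icc 1 (j ^ 2), z n‖ + 2 * j) / (j : ℝ) ^ 2 := by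
        gcongr
        exact (norm_add_le _ _).trans (by gcongr)
    _ = _ := by field_simp

open MeasureTheory ProbabilityTheory in
lemma aux_ae (b : ℕ → ℝ) (δ : ℝ) (hδ : 0 < δ)
    (hsep : ∀ n m : ℕ, 1 ≤ n → 1 ≤ m → n ≠ m → δ ≤ |b n - b m|) :
    ∀ᵐ x : ℝ, Tendsto (fun N : ℕ =>
      (∑ n ∈ Finset.Icc 1 N, Complex.exp (x * b n * Complex.I)) / (N : ℂ)) atTop (nhds 0) := by
  obtain ⟨C, hC0, hC⟩ := aux_sep_bound b δ hδ hsep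
  refine (gaussianReal_absolutelyContinuous' 0 (one_ne_zero : (1 : NNReal) ≠ 0)).ae_le ?_
  set F : ℕ → ℝ → ℝ := fun j x =>
    (‖∑ n ∈ Finset.Icc 1 (j ^ 2), Complex.exp (x * b n * Complex.I)‖ / (j : ℝ) ^ 2) ^ 2 with hF
  have hFm : ∀ j, Continuous (F j) := by intro j; simp only [hF]; fun_prop
  have hF0 : ∀ j x, 0 ≤ F j x := fun j x => by positivity
  have hFint : ∀ j, Integrable (F j) (gaussianReal 0 1) := by
    intro j
    refine Integrable.of_bound (C := (((j ^ 2 : ℕ) : ℝ) / (j : ℝ) ^ 2) ^ 2)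
      (hFm j).aestronglyMeasurable (ae_of_all _ fun x => ?_)
    rw [Real.norm_of_nonneg (hF0 j x)]
    simp only [hF]
    gcongr
    refine (norm_sum_le_of_le _ (f := fun n => Complex.exp (x * b n * Complex.I)) (n := fun _ => (1:ℝ))
      (fun n _ => ?_)).trans ?_
    · rw [← Complex.ofReal_mul, Complex.norm_exp_ofReal_mul_I]
    · simp
  have hI : ∀ j, ∫ x, F j x ∂(gaussianReal 0 1) ≤ C * (1 / (j : ℝ) ^ 2) := by
    intro j
    simp only [hF, div_pow]
    rw [integral_div, aux_moment]
    rcases Nat.eq_zero_or_pos j with rfl | hj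
    · simp
    have hj0 : (0:ℝ) < j := by exact_mod_cast hj
    have : ∑ n ∈ Finset.Icc 1 (j ^ 2), ∑ m ∈ Finset.Icc 1 (j ^ 2),
        Real.exp (-(b n - b m) ^ 2 / 2) ≤ (j : ℝ) ^ 2 * C := by
      refine (Finset.sum_le_sum fun n _ => hC (j ^ 2) n).trans ?_
      simp
    calc _ ≤ ((j : ℝ) ^ 2 * C) / ((j : ℝ) ^ 2) ^ 2 := by gcongr
      _ = _ := by field_simp
  have hsum : ∑' j, ∫⁻ x, ENNReal.ofReal (F j x) ∂(gaussianReal 0 1) ≠ ⊤ := by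
    have hs : Summable (fun j : ℕ => C * (1 / (j : ℝ) ^ 2)) :=
      (Real.summable_one_div_nat_pow.mpr (by norm_num : 1 < 2)).mul_left C
    refine ne_top_of_le_ne_top hs.tsum_ofReal_ne_top (ENNReal.tsum_le_tsum fun j => ?_)
    rw [← ofReal_integral_eq_lintegral_ofReal (hFint j) (ae_of_all _ (hF0 j))]
    exact ENNReal.ofReal_le_ofReal (hI j)
  rw [← lintegral_tsum (fun j => ((hFm j).measurable.ennreal_ofReal).aemeasurable)] at hsum
  have hae := ae_lt_top' (AEMeasurable.tsum fun j => ((hFm j).measurable.ennreal_ofReal).aemeasurable) hsum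
  filter_upwards [hae] with x hx
  refine aux_fill (fun n => Complex.exp (x * b n * Complex.I)) (fun n => ?_) ?_
  · rw [← Complex.ofReal_mul, Complex.norm_exp_ofReal_mul_I]
  have h1 := ENNReal.tendsto_atTop_zero_of_tsum_ne_top hx.ne
  have h2 := (ENNReal.tendsto_toReal ENNReal.zero_ne_top).comp h1
  have h3 : Tendsto (fun j => F j x) atTop (nhds 0) := by
    refine (h2.congr fun j => ?_)
    simp [ENNReal.toReal_ofReal (hF0 j x)]
  have h4 := h3.sqrt
  rw [Real.sqrt_zero] at h4
  refine h4.congr fun j => ?_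
  simp only [hF]
  exact Real.sqrt_sq (by positivity)

open MeasureTheory in
lemma aux_weyl_cont (x : ℕ → UnitAddCircle)
    (h : ∀ k : ℤ, k ≠ 0 → Tendsto (fun N : ℕ =>
      (∑ n ∈ Finset.Icc 1 N, fourier k (x n)) / (N : ℂ)) atTop (nhds 0))
    (f : C(UnitAddCircle, ℂ)) :
    Tendsto (fun N : ℕ => (∑ n ∈ Finset.Icc 1 N, f (x n)) / (N : ℂ)) atTop
      (nhds (∫ y, f y)) := by
  have hint : ∀ f : C(UnitAddCircle, ℂ), Integrable f := fun f =>
    f.continuous.integrable_of_hasCompactSupport (HasCompactSupport.of_compactSpace _)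
  have hspan : ∀ g ∈ Submodule.span ℂ (Set.range (@fourier (1:ℝ))),
      Tendsto (fun N : ℕ => (∑ n ∈ Finset.Icc 1 N, g (x n)) / (N : ℂ)) atTop
      (nhds (∫ y, g y)) := by
    intro g hg
    induction hg using Submodule.span_induction with
    | mem g hg =>
      obtain ⟨k, rfl⟩ := hg
      by_cases hk : k = 0
      · subst hk
        simp only [fourier_zero]
        have : ∫ y : UnitAddCircle, (1:ℂ) = 1 := by simp [Measure.real]
        rw [this]
        refine tendsto_const_nhds.congr' ?_
        filter_upwards [eventually_ge_atTop 1] with N hN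
        have : (N:ℂ) ≠ 0 := by exact_mod_cast (by omega)
        simp [this]
      · have : ∫ y : UnitAddCircle, fourier k y = 0 :=
          integral_eq_zero_of_add_right_eq_neg (fourier_add_half_inv_index hk one_pos)
        rw [this]
        exact h k hk
    | zero => simp
    | add g₁ g₂ _ _ h₁ h₂ =>
      simp only [ContinuousMap.add_apply, Finset.sum_add_distrib, add_div]
      rw [integral_add (hint g₁) (hint g₂)]
      exact h₁.add h₂
    | smul c g _ h₁ =>
      simp only [ContinuousMap.smul_apply, smul_eq_mul, ← Finset.mul_sum, mul_div_assoc]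
      rw [integral_const_mul]
      exact h₁.const_mul c
  have hf : f ∈ (Submodule.span ℂ (Set.range (@fourier (1:ℝ)))).topologicalClosure := by
    rw [span_fourier_closure_eq_top]; trivial
  rw [← SetLike.mem_coe, Submodule.topologicalClosure_coe, Metric.mem_closure_iff] at hf
  rw [Metric.tendsto_atTop]
  intro ε hε
  obtain ⟨g, hg, hfg⟩ := hf (ε / 3) (by positivity)
  obtain ⟨N₀, hN₀⟩ := Metric.tendsto_atTop.mp (hspan g hg) (ε / 3) (by positivity)
  refine ⟨N₀, fun N hN => ?_⟩
  have hpt : ∀ y, ‖f y - g y‖ ≤ ε / 3 := fun y => by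
    rw [← dist_eq_norm]
    exact (ContinuousMap.dist_apply_le_dist y).trans hfg.le
  have h1 : ‖(∑ n ∈ Finset.Icc 1 N, f (x n)) / (N : ℂ)
      - (∑ n ∈ Finset.Icc 1 N, g (x n)) / (N : ℂ)‖ ≤ ε / 3 := by
    rw [← sub_div, ← Finset.sum_sub_distrib, norm_div, Complex.norm_natCast]
    refine div_le_of_le_mul₀ (by positivity) (by positivity) ?_
    refine (norm_sum_le_of_le _ (fun n _ => hpt (x n))).trans ?_
    simp [mul_comm]
  have h2 : ‖(∫ y, g y) - ∫ y, f y‖ ≤ ε / 3 := by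
    rw [← integral_sub (hint g) (hint f)]
    refine (norm_integral_le_of_norm_le_const (C := ε / 3)
      (ae_of_all _ fun y => by rw [norm_sub_rev]; exact hpt y)).trans ?_
    simp [Measure.real]
  have h3 := hN₀ N hN
  rw [dist_eq_norm] at h3 ⊢
  calc _ = ‖((∑ n ∈ Finset.Icc 1 N, f (x n)) / (N : ℂ)
      - (∑ n ∈ Finset.Icc 1 N, g (x n)) / (N : ℂ)) +
      ((∑ n ∈ Finset.Icc 1 N, g (x n)) / (N : ℂ) - ∫ y, g y) + ((∫ y, g y) - ∫ y, f y)‖ := by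
        congr 1; ring
    _ ≤ _ := norm_add₃_le
    _ < ε := by linarith

open MeasureTheory in
lemma aux_arc (u v : ℝ) (hu : 0 ≤ u) (huv : u ≤ v) (hv : v ≤ 1) :
    volume (frontier (((↑) : ℝ → UnitAddCircle) '' Set.Ico u v)) = 0 ∧
    volume (((↑) : ℝ → UnitAddCircle) '' Set.Ico u v) = ENNReal.ofReal (v - u) := by
  set q : ℝ → UnitAddCircle := (↑) with hq
  have hsing : ∀ y : UnitAddCircle, volume ({y} : Set UnitAddCircle) = 0 := by
    intro y
    have := AddCircle.volume_closedBall (T := 1) (x := y) 0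
    simpa using this
  have hcont : Continuous q := AddCircle.continuous_mk' 1
  have hopen : IsOpenMap q := QuotientAddGroup.isOpenMap_coe
  have hpair : volume ({q u, q v} : Set UnitAddCircle) = 0 := by
    rw [Set.insert_eq]; exact measure_union_null (hsing _) (hsing _)
  constructor
  · refine measure_mono_null ?_ hpair
    have h1 : closure (q '' Set.Ico u v) ⊆ q '' Set.Icc u v :=
      closure_minimal (Set.image_mono Set.Ico_subset_Icc_self)
        (isCompact_Icc.image hcont).isClosed
    have h2 : q '' Set.Ioo u v ⊆ interior (q '' Set.Ico u v) :=
      interior_maximal (Set.image_mono Set.Ioo_subset_Ico_self) (hopen _ isOpen_Ioo)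
    rintro y ⟨hy1, hy2⟩
    obtain ⟨t, ht, rfl⟩ := h1 hy1
    rcases eq_or_lt_of_le ht.1 with rfl | h3
    · simp
    rcases eq_or_lt_of_le ht.2 with rfl | h4
    · simp
    exact absurd (h2 ⟨t, ⟨h3, h4⟩, rfl⟩) hy2
  · have hae : volume (q '' Set.Ico u v) = volume (q '' Set.Ioo u v) := by
      refine le_antisymm ?_ (measure_mono (Set.image_mono Set.Ioo_subset_Ico_self))
      calc volume (q '' Set.Ico u v) ≤ volume (q '' Set.Ioo u v ∪ {q u}) := by
            refine measure_mono ?_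
            rintro _ ⟨t, ht, rfl⟩
            rcases eq_or_lt_of_le ht.1 with rfl | h3
            · simp
            · exact Or.inl ⟨t, ⟨h3, ht.2⟩, rfl⟩
        _ ≤ _ := (measure_union_le _ _).trans (by simp [hsing])
    rw [hae, AddCircle.add_projection_respects_measure 1 0 (hopen _ isOpen_Ioo).measurableSet]
    have : (QuotientAddGroup.mk ⁻¹' (q '' Set.Ioo u v) ∩ Set.Ioc (0:ℝ) (0 + 1)) = Set.Ioo u v := by
      ext t
      constructor
      · rintro ⟨⟨s, hs, hst⟩, ht⟩
        have := (AddCircle.coe_eq_coe_iff_of_mem_Ioc (p := (1:ℝ)) (a := 0)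
          (show s ∈ Set.Ioc (0:ℝ) (0+1) from ⟨by linarith [hs.1], by linarith [hs.2]⟩) ht).mp hst
        exact this ▸ hs
      · intro ht
        exact ⟨⟨t, ht, rfl⟩, by linarith [ht.1], by linarith [ht.2]⟩
    rw [this, Real.volume_Ioo]

lemma aux_mem_arc (u v t : ℝ) (hu : 0 ≤ u) (hv : v ≤ 1) :
    ((t : UnitAddCircle) ∈ ((↑) : ℝ → UnitAddCircle) '' Set.Ico u v) ↔
      Int.fract t ∈ Set.Ico u v := by
  have hft : ((Int.fract t : ℝ) : UnitAddCircle) = t := by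
    rw [← Int.self_sub_floor]
    simp
  constructor
  · rintro ⟨s, hs, hst⟩
    have := (AddCircle.coe_eq_coe_iff_of_mem_Ico (p := (1:ℝ)) (a := 0)
      (show s ∈ Set.Ico (0:ℝ) (0+1) from ⟨by linarith [hs.1], by linarith [hs.2]⟩)
      (show Int.fract t ∈ Set.Ico (0:ℝ) (0+1) from
        ⟨Int.fract_nonneg t, by simpa using Int.fract_lt_one t⟩)).mp (hst.trans hft.symm)
    exact this ▸ hs
  · intro h
    exact ⟨_, h, hft⟩

open MeasureTheory in
lemma aux_weyl (x : ℕ → ℝ)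
    (h : ∀ k : ℤ, k ≠ 0 → Tendsto (fun N : ℕ =>
      (∑ n ∈ Finset.Icc 1 N, fourier k (x n : UnitAddCircle)) / (N : ℂ)) atTop (nhds 0))
    (u v : ℝ) (hu : 0 ≤ u) (huv : u ≤ v) (hv : v ≤ 1) :
    Tendsto (fun N : ℕ =>
          (((Finset.Icc 1 N).filter (fun n => Int.fract (x n) ∈ Set.Ico u v)).card : ℝ) / N)
        atTop (nhds (v - u)) := by
  classical
  rw [← tendsto_add_atTop_iff_nat 1]
  set m : ℕ → Measure UnitAddCircle := fun N =>
    ((N + 1 : ℕ) : ENNReal)⁻¹ • ∑ n ∈ Finset.Icc 1 (N + 1), Measure.dirac (x n : UnitAddCircle)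
    with hm
  have hprob : ∀ N, IsProbabilityMeasure (m N) := by
    intro N
    constructor
    simp only [hm, Measure.smul_apply, Measure.finsetSum_apply, measure_univ, smul_eq_mul]
    simp only [Finset.sum_const, Nat.card_Icc, nsmul_eq_mul, mul_one, add_tsub_cancel_right]
    exact ENNReal.inv_mul_cancel (by simp) (ENNReal.natCast_ne_top _)
  have hvol : IsProbabilityMeasure (volume : Measure UnitAddCircle) := ⟨by simp⟩
  set μs : ℕ → ProbabilityMeasure UnitAddCircle := fun N => ⟨m N, hprob N⟩ with hμs
  obtain ⟨P, hP⟩ : ∃ P : ProbabilityMeasure UnitAddCircle,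
      (P : Measure UnitAddCircle) = volume := ⟨⟨volume, hvol⟩, rfl⟩
  have hlim : Tendsto μs atTop (nhds P) := by
    refine ProbabilityMeasure.tendsto_iff_forall_integral_tendsto.mpr fun f => ?_
    rw [hP]
    have h1 := aux_weyl_cont (fun n => (x n : UnitAddCircle)) h
      ⟨fun y => (f y : ℂ), by fun_prop⟩
    rw [← tendsto_add_atTop_iff_nat 1] at h1
    have h2 := (Complex.continuous_re.tendsto _).comp h1
    have h3 : ∫ y : UnitAddCircle, (f y : ℂ) = ((∫ y, f y : ℝ) : ℂ) := integral_ofReal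
    simp only [ContinuousMap.coe_mk] at h2
    rw [h3, Complex.ofReal_re] at h2
    refine h2.congr fun N => ?_
    simp only [hμs, ProbabilityMeasure.coe_mk, hm, Function.comp]
    rw [integral_smul_measure, integral_finsetSum_measure]
    · simp only [integral_dirac]
      rw [← Complex.ofReal_sum, ← Complex.ofReal_natCast, ← Complex.ofReal_div, Complex.ofReal_re]
      rw [ENNReal.toReal_inv, ENNReal.toReal_natCast, smul_eq_mul, div_eq_inv_mul]
    · intro n _
      exact f.integrable _
  obtain ⟨hfr, hvolA⟩ := aux_arc u v hu huv hv
  have h4 := ProbabilityMeasure.tendsto_measure_of_null_frontier_of_tendsto' hlim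
    (by rw [hP]; exact hfr)
  rw [hP, hvolA] at h4
  have h5 := (ENNReal.tendsto_toReal ENNReal.ofReal_ne_top).comp h4
  rw [ENNReal.toReal_ofReal (by linarith)] at h5
  refine h5.congr fun N => ?_
  simp only [Function.comp, hμs, ProbabilityMeasure.coe_mk, hm, Measure.smul_apply, Measure.finsetSum_apply,
    smul_eq_mul, Measure.dirac_apply]
  simp only [Set.indicator_apply, aux_mem_arc u v _ hu hv, Pi.one_apply]
  rw [Finset.sum_boole, ENNReal.toReal_mul, ENNReal.toReal_inv, ENNReal.toReal_natCast,
    ENNReal.toReal_natCast, div_eq_inv_mul]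

theorem stmt12 (a : ℕ → ℝ) (δ : ℝ) (hδ : 0 < δ)
    (hsep : ∀ n m : ℕ, 1 ≤ n → 1 ≤ m → n ≠ m → δ ≤ |a n - a m|) :
    ∀ᵐ α : ℝ, ∀ u v : ℝ, 0 ≤ u → u ≤ v → v ≤ 1 →
      Tendsto (fun N : ℕ =>
          (((Finset.Icc 1 N).filter (fun n => Int.fract (α * a n) ∈ Set.Ico u v)).card : ℝ) / N)
        atTop (nhds (v - u)) := by
  have hk : ∀ k : ℤ, ∀ᵐ α : ℝ, k ≠ 0 → Tendsto (fun N : ℕ =>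
      (∑ n ∈ Finset.Icc 1 N, fourier k ((α * a n : ℝ) : UnitAddCircle)) / (N : ℂ))
      atTop (nhds 0) := by
    intro k
    by_cases hk : k = 0
    · simp [hk]
    have hk' : 0 < |(k : ℝ)| := by positivity
    have hpi := Real.pi_pos
    have := aux_ae (fun n => 2 * Real.pi * k * a n) (2 * Real.pi * |(k : ℝ)| * δ) (by positivity)
      (fun n m hn hm hnm => by
        rw [← mul_sub, abs_mul, abs_mul, abs_of_pos (by positivity : 0 < 2 * Real.pi)]
        gcongr
        exact hsep n m hn hm hnm)
    filter_upwards [this] with α hα _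
    refine hα.congr fun N => ?_
    congr 1
    refine Finset.sum_congr rfl fun n _ => ?_
    rw [fourier_coe_apply]
    congr 1
    push_cast
    ring
  filter_upwards [MeasureTheory.ae_all_iff.mpr hk] with α hα u v hu huv hv
  exact aux_weyl (fun n => α * a n) hα u v hu huv hv
end

section
/- Let r ≥ 1, M ≥ 1. In the degenerate case of the counting argument: the number of vectors (y_1,...,y_{2k}, z_1,...,z_{2k}) ∈ ℤ^{4k} with |y_i| ≤ M, 1 ≤ z_i ≤ M, such that the index set {1,...,2k} partitions into blocks on which the y-coordinates sum to zero (with exactly s pairs {i, k+i}, 1 ≤ s ≤ k, being matched: z_i = z_{k+i}, y_i + y_{k+i} = 0, and y_j = 0 for the remaining unmatched indices), and y_1 + ... + y_k = 0, is O(M^{2k−1}). -/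
/-- Two admissible vectors with the same parameter `s` and the same `2k-1` free coordinates agree. -/
theorem degenerate_inj (k s : ℕ) (h1 : 1 ≤ s) (hsk : s ≤ k)
    (p q : (Fin (2 * k) → ℤ) × (Fin (2 * k) → ℕ))
    (hp : ∀ i : ℕ, (hi : i < s) → (hs : s ≤ k) →
              p.2 ⟨i, by omega⟩ = p.2 ⟨i + k, by omega⟩ ∧
              p.1 ⟨i, by omega⟩ + p.1 ⟨i + k, by omega⟩ = 0)
    (hp0 : ∀ i : ℕ, (hi : i < 2 * k) → s ≤ i → (i < k ∨ k + s ≤ i) → p.1 ⟨i, by omega⟩ = 0)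
    (hpS : ∑ i ∈ Finset.univ.filter (fun i : Fin (2 * k) => (i : ℕ) < k), p.1 i = 0)
    (hq : ∀ i : ℕ, (hi : i < s) → (hs : s ≤ k) →
              q.2 ⟨i, by omega⟩ = q.2 ⟨i + k, by omega⟩ ∧
              q.1 ⟨i, by omega⟩ + q.1 ⟨i + k, by omega⟩ = 0)
    (hq0 : ∀ i : ℕ, (hi : i < 2 * k) → s ≤ i → (i < k ∨ k + s ≤ i) → q.1 ⟨i, by omega⟩ = 0)
    (hqS : ∑ i ∈ Finset.univ.filter (fun i : Fin (2 * k) => (i : ℕ) < k), q.1 i = 0)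
    (hy : ∀ i : ℕ, (hi : i + 1 < s) → p.1 ⟨i, by omega⟩ = q.1 ⟨i, by omega⟩)
    (hz : ∀ i : ℕ, (hi : i < 2 * k) → s ≤ i → p.2 ⟨i, hi⟩ = q.2 ⟨i, hi⟩) : p = q := by
  have hlast : p.1 ⟨s - 1, by omega⟩ = q.1 ⟨s - 1, by omega⟩ := by
    have hd : ∑ i ∈ Finset.univ.filter (fun i : Fin (2 * k) => (i : ℕ) < k),
        (p.1 i - q.1 i) = 0 := by
      rw [Finset.sum_sub_distrib, hpS, hqS, sub_zero]
    rw [Finset.sum_eq_single (⟨s - 1, by omega⟩ : Fin (2 * k))] at hd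
    · exact sub_eq_zero.mp hd
    · rintro ⟨i, hi⟩ hik hne
      simp only [Finset.mem_filter, Finset.mem_univ, true_and] at hik
      have hne' : i ≠ s - 1 := fun h => hne (Fin.ext h)
      by_cases h : i + 1 < s
      · rw [hy i h, sub_self]
      · rw [hp0 i hi (by omega) (Or.inl hik), hq0 i hi (by omega) (Or.inl hik), sub_self]
    · intro h
      exact absurd (Finset.mem_filter.mpr ⟨Finset.mem_univ _, by show s - 1 < k; omega⟩) h
  have hys : ∀ i : ℕ, (hi : i < s) → p.1 ⟨i, by omega⟩ = q.1 ⟨i, by omega⟩ := by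
    intro i hi
    by_cases h : i + 1 < s
    · exact hy i h
    · obtain rfl : i = s - 1 := by omega
      exact hlast
  refine Prod.ext (funext ?_) (funext ?_)
  · rintro ⟨i, hi⟩
    by_cases h : i < s
    · exact hys i h
    by_cases h' : i < k ∨ k + s ≤ i
    · rw [hp0 i hi (by omega) h', hq0 i hi (by omega) h']
    · obtain ⟨j, rfl⟩ : ∃ j, i = j + k := ⟨i - k, by omega⟩
      have a := (hp j (by omega) hsk).2
      have b := (hq j (by omega) hsk).2
      have c := hys j (by omega)
      omega
  · rintro ⟨i, hi⟩
    by_cases h : i < s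
    · rw [(hp i h hsk).1, (hq i h hsk).1]
      exact hz _ _ (by omega)
    · exact hz _ _ (by omega)

theorem stmt13 (k : ℕ) (hk : 2 ≤ k) :
    ∃ K0 : ℝ, 0 < K0 ∧ ∀ M : ℝ, 1 ≤ M →
      ({p : (Fin (2 * k) → ℤ) × (Fin (2 * k) → ℕ) |
          (∀ i, |(p.1 i : ℝ)| ≤ M) ∧
          (∀ i, 1 ≤ p.2 i ∧ (p.2 i : ℝ) ≤ M) ∧
          (∃ s : ℕ, 1 ≤ s ∧ s ≤ k ∧
            (∀ i : ℕ, (hi : i < s) → (hs : s ≤ k) →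
              p.2 ⟨i, by omega⟩ = p.2 ⟨i + k, by omega⟩ ∧
              p.1 ⟨i, by omega⟩ + p.1 ⟨i + k, by omega⟩ = 0) ∧
            (∀ i : ℕ, (hi : i < 2 * k) → s ≤ i → (i < k ∨ k + s ≤ i) →
              p.1 ⟨i, by omega⟩ = 0)) ∧
          ∑ i ∈ Finset.univ.filter (fun i : Fin (2 * k) => (i : ℕ) < k), p.1 i = 0}.ncard : ℝ) ≤
        K0 * M ^ (2 * k - 1) := by
  classical
  refine ⟨k * 3 ^ (2 * k - 1), by positivity, fun M hM => ?_⟩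
  set S := {p : (Fin (2 * k) → ℤ) × (Fin (2 * k) → ℕ) | _} with hS
  have hex : ∀ p : (Fin (2 * k) → ℤ) × (Fin (2 * k) → ℕ), p ∈ S → _ := fun p hp => hp.2.2.1
  choose! s hs1 hs2 hs3 hs4 using hex
  let N : ℤ := ⌊M⌋
  let T : Finset (ℕ × (Fin (2 * k - 1) → ℤ)) :=
    Finset.Icc 1 k ×ˢ Fintype.piFinset (fun _ => Finset.Icc (-N) N)
  let f : (Fin (2 * k) → ℤ) × (Fin (2 * k) → ℕ) → ℕ × (Fin (2 * k - 1) → ℤ) := fun p =>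
    (s p, fun j => if (j : ℕ) + 1 < s p then p.1 ⟨j, by omega⟩
      else ((p.2 ⟨j + 1, by omega⟩ : ℕ) : ℤ))
  have hmaps : ∀ p ∈ S, f p ∈ (T : Set (ℕ × (Fin (2 * k - 1) → ℤ))) := by
    intro p hp
    simp only [T, f, Finset.mem_coe, Finset.mem_product, Finset.mem_Icc, Fintype.mem_piFinset]
    refine ⟨⟨hs1 p hp, hs2 p hp⟩, fun j => ?_⟩
    split_ifs with h
    · have := abs_le.mp (hp.1 ⟨j, by omega⟩)
      refine ⟨?_, Int.le_floor.mpr this.2⟩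
      have h2 : -p.1 ⟨j, by omega⟩ ≤ N := Int.le_floor.mpr (by push_cast; linarith [this.1])
      linarith
    · have h3 := (hp.2.1 ⟨j + 1, by omega⟩).2
      have h4 : ((p.2 ⟨j + 1, by omega⟩ : ℕ) : ℤ) ≤ N := Int.le_floor.mpr (by exact_mod_cast h3)
      refine ⟨?_, h4⟩
      have : (0 : ℤ) ≤ ((p.2 ⟨j + 1, by omega⟩ : ℕ) : ℤ) := Int.natCast_nonneg _
      linarith
  have hinj : Set.InjOn f S := by
    intro p hp q hq hpq
    have e1 : s p = s q := congrArg Prod.fst hpq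
    have e2 := congrArg Prod.snd hpq
    have a3 := hs3 q hq
    have a4 := hs4 q hq
    rw [← e1] at a4
    refine degenerate_inj k (s p) (hs1 p hp) (hs2 p hp) p q (hs3 p hp) (hs4 p hp) hp.2.2.2
      (fun i hi hsk => a3 i (e1 ▸ hi) (e1 ▸ hsk)) a4 hq.2.2.2 ?_ ?_
    · intro i hi
      have hk' := hs2 p hp
      have := congrFun e2 ⟨i, by omega⟩
      simp only [f] at this
      rwa [if_pos hi, if_pos (e1 ▸ hi)] at this
    · intro i hi hsi
      have h1' := hs1 p hp
      obtain ⟨j, rfl⟩ : ∃ j, i = j + 1 := ⟨i - 1, by omega⟩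
      have := congrFun e2 ⟨j, by omega⟩
      simp only [f] at this
      rw [if_neg (by omega), if_neg (by omega)] at this
      exact_mod_cast this
  have hcard := Set.ncard_le_ncard_of_injOn f hmaps hinj T.finite_toSet
  rw [Set.ncard_coe_finset] at hcard
  have hT : T.card = k * (2 * N + 1).toNat ^ (2 * k - 1) := by
    simp only [T, Finset.card_product, Fintype.card_piFinset, Nat.card_Icc, Int.card_Icc,
      Finset.prod_const, Finset.card_univ, Fintype.card_fin, Nat.add_sub_cancel]
    congr 3
    ring
  have hN0 : (0 : ℤ) ≤ N := Int.floor_nonneg.mpr (by linarith)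
  have hNM : (((2 * N + 1).toNat : ℕ) : ℝ) ≤ 3 * M := by
    have h5 : (((2 * N + 1).toNat : ℕ) : ℤ) = 2 * N + 1 := Int.toNat_of_nonneg (by linarith)
    have h6 : (((2 * N + 1).toNat : ℕ) : ℝ) = 2 * (N : ℝ) + 1 := by exact_mod_cast h5
    have h7 : (N : ℝ) ≤ M := Int.floor_le M
    rw [h6]; linarith
  calc (S.ncard : ℝ) ≤ (T.card : ℝ) := by exact_mod_cast hcard
    _ = k * (((2 * N + 1).toNat : ℕ) : ℝ) ^ (2 * k - 1) := by rw [hT]; push_cast; rfl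
    _ ≤ k * (3 * M) ^ (2 * k - 1) := by gcongr
    _ = k * 3 ^ (2 * k - 1) * M ^ (2 * k - 1) := by rw [mul_pow]; ring
end
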